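/- Let (v, B, p) be a smooth solution of the stationary MHD system in ℝ³ with v, B ∈ BMO^{−1}(ℝ³), i.e., there exist matrix potentials Φ, Ψ with ∇·Φ = v, ∇·Ψ = B whose entries lie in BMO(ℝ³). Then v ≡ 0 and B ≡ 0. -/

import Mathlib

open MeasureTheory

noncomputable abbrev E3 : Type := EuclideanSpace ℝ (Fin 3)

/-- Partial derivative `∂_i f (x)`. -/
noncomputable def pd (f : E3 → ℝ) (i : Fin 3) (x : E3) : ℝ :=
  fderiv ℝ f x (EuclideanSpace.single i 1)

/-- Laplacian `Δf = ∑_i ∂_i∂_i f`. -/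
noncomputable def lap (f : E3 → ℝ) (x : E3) : ℝ :=
  ∑ i, pd (fun y => pd f i y) i x

/-- Divergence of a vector field. -/
noncomputable def divg (F : E3 → Fin 3 → ℝ) (x : E3) : ℝ :=
  ∑ i, pd (fun y => F y i) i x

/-- Divergence of a matrix field: `(∇·Φ)_j = ∑_i ∂_i Φ_{ij}`. -/
noncomputable def matDiv (Φ : E3 → Fin 3 → Fin 3 → ℝ) (x : E3) (j : Fin 3) : ℝ :=
  ∑ i, pd (fun y => Φ y i j) i x

/-- A matrix field is in BMO: its mean oscillation over all balls is uniformly bounded. -/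
def IsBMO (Φ : E3 → Fin 3 → Fin 3 → ℝ) : Prop :=
  ∃ K : ℝ, ∀ (z : E3) (r : ℝ), 0 < r →
    (⨍ x in Metric.ball z r,
      ‖(fun (i j : Fin 3) => Φ x i j - ⨍ y in Metric.ball z r, Φ y i j)‖) ≤ K



/-! ### Calculus with partial derivatives -/

theorem differentiable_of_smooth {f : E3 → ℝ} (hf : ContDiff ℝ (⊤ : ℕ∞) f) :
    Differentiable ℝ f :=
  hf.differentiable (by simp)

theorem smooth_pd {f : E3 → ℝ} (hf : ContDiff ℝ (⊤ : ℕ∞) f) (i : Fin 3) :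
    ContDiff ℝ (⊤ : ℕ∞) (pd f i) := by
  have h : ContDiff ℝ (⊤ : ℕ∞) (fderiv ℝ f) := hf.fderiv_right (by simp)
  exact h.clm_apply contDiff_const

theorem continuous_pd {f : E3 → ℝ} (hf : ContDiff ℝ (⊤ : ℕ∞) f) (i : Fin 3) :
    Continuous (pd f i) :=
  (smooth_pd hf i).continuous

theorem pd_mul {f g : E3 → ℝ} (hf : Differentiable ℝ f) (hg : Differentiable ℝ g)
    (i : Fin 3) (x : E3) :
    pd (fun y => f y * g y) i x = pd f i x * g x + f x * pd g i x := by
  unfold pd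
  rw [fderiv_fun_mul (hf x) (hg x)]
  simp [mul_comm]
  ring

theorem pd_add {f g : E3 → ℝ} (hf : Differentiable ℝ f) (hg : Differentiable ℝ g)
    (i : Fin 3) (x : E3) :
    pd (fun y => f y + g y) i x = pd f i x + pd g i x := by
  unfold pd
  rw [fderiv_fun_add (hf x) (hg x)]
  simp

theorem pd_sub {f g : E3 → ℝ} (hf : Differentiable ℝ f) (hg : Differentiable ℝ g)
    (i : Fin 3) (x : E3) :
    pd (fun y => f y - g y) i x = pd f i x - pd g i x := by
  unfold pd
  rw [fderiv_fun_sub (hf x) (hg x)]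
  simp

theorem pd_sub_const (f : E3 → ℝ) (c : ℝ) (i : Fin 3) (x : E3) :
    pd (fun y => f y - c) i x = pd f i x := by
  unfold pd
  rw [fderiv_sub_const]

theorem hasFDerivAt_shift {f : E3 → ℝ} (hf : Differentiable ℝ f) (x : E3) (c : ℝ) (y : E3) :
    HasFDerivAt (fun z => f (x - c • z))
      ((fderiv ℝ f (x - c • y)).comp (-(c • ContinuousLinearMap.id ℝ E3))) y := by
  have h1 : HasFDerivAt (fun z : E3 => x - c • z) (-(c • ContinuousLinearMap.id ℝ E3)) y :=
    ((hasFDerivAt_id y).const_smul c).const_sub x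
  exact (hf (x - c • y)).hasFDerivAt.comp y h1

theorem pd_shift {f : E3 → ℝ} (hf : Differentiable ℝ f) (x : E3) (c : ℝ) (i : Fin 3) (y : E3) :
    pd (fun z => f (x - c • z)) i y = -(c * pd f i (x - c • y)) := by
  unfold pd
  rw [(hasFDerivAt_shift hf x c y).fderiv]
  simp

theorem smooth_shift {f : E3 → ℝ} (hf : ContDiff ℝ (⊤ : ℕ∞) f) (x : E3) (c : ℝ) :
    ContDiff ℝ (⊤ : ℕ∞) (fun z => f (x - c • z)) :=
  hf.comp (contDiff_const.sub (contDiff_id.const_smul c))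

/-- The derivative of a function applied to a vector, in coordinates. -/
theorem fderiv_apply_eq_sum_pd (f : E3 → ℝ) (x y : E3) :
    fderiv ℝ f x y = ∑ i, y i * pd f i x := by
  have hy : y = ∑ i, y i • EuclideanSpace.single i (1 : ℝ) := by
    ext j
    simp [Finset.sum_apply, Pi.single_apply]
  conv_lhs => rw [hy]
  simp [pd]

/-- The integral of a partial derivative of a compactly supported function vanishes. -/
theorem integral_pd_eq_zero {f : E3 → ℝ} (hf : ContDiff ℝ (⊤ : ℕ∞) f) (hc : HasCompactSupport f)
    (i : Fin 3) : ∫ x, pd f i x = 0 := by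
  have h := integral_mul_fderiv_eq_neg_fderiv_mul_of_integrable (μ := (volume : Measure E3))
    (f := fun _ : E3 => (1 : ℝ)) (g := f) (v := EuclideanSpace.single i 1) ?_ ?_ ?_ ?_ ?_
  · simpa [pd] using h
  · simp
  · simp only [one_mul]
    refine (continuous_pd hf i).integrable_of_hasCompactSupport ?_
    exact hc.fderiv_apply ℝ _
  · simpa using hf.continuous.integrable_of_hasCompactSupport hc
  · exact fun x _ => differentiableAt_const _
  · exact fun x _ => differentiable_of_smooth hf x

theorem integral_mul_pd_eq_neg {f g : E3 → ℝ} (hf : ContDiff ℝ (⊤ : ℕ∞) f)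
    (hg : ContDiff ℝ (⊤ : ℕ∞) g) (hc : HasCompactSupport f) (i : Fin 3) :
    ∫ x, f x * pd g i x = -∫ x, pd f i x * g x := by
  refine integral_mul_fderiv_eq_neg_fderiv_mul_of_integrable ?_ ?_ ?_ ?_ ?_
  · exact ((continuous_pd hf i).mul hg.continuous).integrable_of_hasCompactSupport
      ((hc.fderiv_apply ℝ _).mul_right)
  · exact (hf.continuous.mul (continuous_pd hg i)).integrable_of_hasCompactSupport hc.mul_right
  · exact (hf.continuous.mul hg.continuous).integrable_of_hasCompactSupport hc.mul_right
  · exact fun x _ => differentiable_of_smooth hf x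
  · exact fun x _ => differentiable_of_smooth hg x

/-- Moving a derivative from an averaged function to the averaging kernel. -/
theorem integral_mul_pd_shift {k f : E3 → ℝ} (hk : ContDiff ℝ (⊤ : ℕ∞) k)
    (hf : ContDiff ℝ (⊤ : ℕ∞) f) (hc : HasCompactSupport k) {c : ℝ} (hc0 : c ≠ 0)
    (i : Fin 3) (x : E3) :
    ∫ y, k y * pd f i (x - c • y) = c⁻¹ * ∫ y, pd k i y * f (x - c • y) := by
  have h := integral_mul_pd_eq_neg hk (smooth_shift hf x c) hc i
  have h2 : ∀ y, k y * pd (fun z => f (x - c • z)) i y = -c * (k y * pd f i (x - c • y)) := by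
    intro y
    rw [pd_shift (differentiable_of_smooth hf)]
    ring
  simp only [h2] at h
  rw [integral_const_mul] at h
  field_simp
  linarith


/-! ### Radial cutoff functions and a radial mollifier -/

theorem deriv_smoothTransition_nonneg (t : ℝ) : 0 ≤ deriv Real.smoothTransition t :=
  Real.smoothTransition.monotone.deriv_nonneg

theorem deriv_smoothTransition_of_nonpos {t : ℝ} (ht : t ≤ 0) :
    deriv Real.smoothTransition t = 0 := by
  have hmin : IsLocalMin Real.smoothTransition t :=
    Filter.Eventually.of_forall fun s => by
      rw [Real.smoothTransition.zero_of_nonpos ht]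
      exact Real.smoothTransition.nonneg s
  exact hmin.deriv_eq_zero

theorem deriv_smoothTransition_of_one_le {t : ℝ} (ht : 1 ≤ t) :
    deriv Real.smoothTransition t = 0 := by
  have hmax : IsLocalMax Real.smoothTransition t :=
    Filter.Eventually.of_forall fun s => by
      rw [Real.smoothTransition.one_of_one_le ht]
      exact Real.smoothTransition.le_one s
  exact hmax.deriv_eq_zero

theorem smooth_deriv_smoothTransition : ContDiff ℝ (⊤ : ℕ∞) (deriv Real.smoothTransition) := by
  have h : ContDiff ℝ (⊤ : ℕ∞) Real.smoothTransition := Real.smoothTransition.contDiff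
  exact (contDiff_infty_iff_deriv.1 h).2

theorem exists_deriv_smoothTransition_le :
    ∃ L : ℝ, 0 < L ∧ ∀ t, deriv Real.smoothTransition t ≤ L := by
  obtain ⟨L, hL⟩ := (isCompact_Icc (a := (0 : ℝ)) (b := 1)).exists_bound_of_continuousOn
    smooth_deriv_smoothTransition.continuous.continuousOn
  refine ⟨max L 1, by positivity, fun t => ?_⟩
  by_cases ht : t ∈ Set.Icc (0 : ℝ) 1
  · exact (le_abs_self _).trans ((hL t ht).trans (le_max_left _ _))
  · have h0 : deriv Real.smoothTransition t = 0 := by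
      by_contra hne
      refine ht ⟨?_, ?_⟩
      · by_contra h
        exact hne (deriv_smoothTransition_of_nonpos (not_le.1 h).le)
      · by_contra h
        exact hne (deriv_smoothTransition_of_one_le (not_le.1 h).le)
    rw [h0]
    positivity

/-- A smooth radial function equal to `1` for `‖x‖ ≤ a` and to `0` for `b ≤ ‖x‖`. -/
noncomputable def radialCutoff (a b : ℝ) (x : E3) : ℝ :=
  Real.smoothTransition ((b ^ 2 - ‖x‖ ^ 2) / (b ^ 2 - a ^ 2))

theorem smooth_radialCutoff (a b : ℝ) : ContDiff ℝ (⊤ : ℕ∞) (radialCutoff a b) := by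
  have h : ContDiff ℝ (⊤ : ℕ∞) Real.smoothTransition := Real.smoothTransition.contDiff
  exact h.comp ((contDiff_const.sub (contDiff_norm_sq ℝ)).div_const _)

theorem pd_radialCutoff (a b : ℝ) (i : Fin 3) (x : E3) :
    pd (radialCutoff a b) i x =
      deriv Real.smoothTransition ((b ^ 2 - ‖x‖ ^ 2) / (b ^ 2 - a ^ 2)) *
        (-(2 * x i) / (b ^ 2 - a ^ 2)) := by
  have h : ContDiff ℝ (⊤ : ℕ∞) Real.smoothTransition := Real.smoothTransition.contDiff
  have h1 := (h.differentiable (by simp) ((b ^ 2 - ‖x‖ ^ 2) / (b ^ 2 - a ^ 2))).hasDerivAt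
  have h2 : HasFDerivAt (fun x : E3 => (b ^ 2 - ‖x‖ ^ 2) / (b ^ 2 - a ^ 2))
      ((b ^ 2 - a ^ 2)⁻¹ • (-(2 • innerSL ℝ x) : E3 →L[ℝ] ℝ)) x := by
    simp only [div_eq_inv_mul]
    exact (((hasStrictFDerivAt_norm_sq x).hasFDerivAt).const_sub (b ^ 2)).const_smul
      ((b ^ 2 - a ^ 2)⁻¹)
  have h3 := h1.comp_hasFDerivAt x h2
  unfold pd
  have h4 : fderiv ℝ (radialCutoff a b) x = _ := h3.fderiv
  rw [h4]
  simp [div_eq_inv_mul, EuclideanSpace.inner_single_right]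

theorem radialCutoff_nonneg (a b : ℝ) (x : E3) : 0 ≤ radialCutoff a b x :=
  Real.smoothTransition.nonneg _

theorem radialCutoff_le_one (a b : ℝ) (x : E3) : radialCutoff a b x ≤ 1 :=
  Real.smoothTransition.le_one _

theorem radialCutoff_eq_one {a b : ℝ} (ha : 0 ≤ a) (hab : a < b) {x : E3} (hx : ‖x‖ ≤ a) :
    radialCutoff a b x = 1 := by
  refine Real.smoothTransition.one_of_one_le ?_
  have h1 : 0 < b ^ 2 - a ^ 2 := by nlinarith
  rw [le_div_iff₀ h1]
  nlinarith [norm_nonneg x]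

theorem arg_radialCutoff_nonpos {a b : ℝ} (ha : 0 ≤ a) (hab : a < b) {x : E3} (hx : b ≤ ‖x‖) :
    (b ^ 2 - ‖x‖ ^ 2) / (b ^ 2 - a ^ 2) ≤ 0 := by
  have h1 : 0 < b ^ 2 - a ^ 2 := by nlinarith
  refine div_nonpos_of_nonpos_of_nonneg ?_ h1.le
  nlinarith [norm_nonneg x]

theorem radialCutoff_eq_zero {a b : ℝ} (ha : 0 ≤ a) (hab : a < b) {x : E3} (hx : b ≤ ‖x‖) :
    radialCutoff a b x = 0 :=
  Real.smoothTransition.zero_of_nonpos (arg_radialCutoff_nonpos ha hab hx)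

theorem pd_radialCutoff_eq_zero {a b : ℝ} (ha : 0 ≤ a) (hab : a < b) (i : Fin 3) {x : E3}
    (hx : b ≤ ‖x‖) : pd (radialCutoff a b) i x = 0 := by
  rw [pd_radialCutoff, deriv_smoothTransition_of_nonpos (arg_radialCutoff_nonpos ha hab hx),
    zero_mul]

theorem hasCompactSupport_of_eq_zero {f : E3 → ℝ} {b : ℝ} (hf : ∀ x, b ≤ ‖x‖ → f x = 0) :
    HasCompactSupport f := by
  refine HasCompactSupport.intro (isCompact_closedBall (0 : E3) b) fun x hx => hf x ?_
  rw [mem_closedBall_zero_iff, not_le] at hx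
  exact hx.le

theorem abs_coord_le_norm (x : E3) (i : Fin 3) : |x i| ≤ ‖x‖ := by
  simpa using PiLp.norm_apply_le x i

theorem abs_pd_radialCutoff_le {L : ℝ} (hL : ∀ t, deriv Real.smoothTransition t ≤ L)
    {a b : ℝ} (ha : 0 ≤ a) (hab : a < b) (i : Fin 3) (x : E3) :
    |pd (radialCutoff a b) i x| ≤ 2 * L / (b - a) := by
  have hL0 : 0 ≤ L := (deriv_smoothTransition_nonneg 0).trans (hL 0)
  have hba : 0 < b - a := by linarith
  rcases le_total b ‖x‖ with hx | hx
  · rw [pd_radialCutoff_eq_zero ha hab i hx, abs_zero]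
    positivity
  · have h1 : 0 < b ^ 2 - a ^ 2 := by nlinarith
    rw [pd_radialCutoff, abs_mul, abs_of_nonneg (deriv_smoothTransition_nonneg _), abs_div,
      abs_of_pos h1, abs_neg, abs_mul, abs_two]
    have h2 : 2 * |x i| / (b ^ 2 - a ^ 2) ≤ 2 / (b - a) := by
      rw [div_le_div_iff₀ h1 hba]
      have := (abs_coord_le_norm x i).trans hx
      nlinarith
    calc _ ≤ L * (2 / (b - a)) := by
          refine mul_le_mul (hL _) h2 (by positivity) hL0
      _ = _ := by ring

/-- A smooth mollifier supported in the unit ball, bounded by `c` together with its first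
derivatives, whose first moment against divergence free fields vanishes. -/
structure IsMollifier (η : E3 → ℝ) (c : ℝ) : Prop where
  smooth : ContDiff ℝ (⊤ : ℕ∞) η
  nonneg : ∀ y, 0 ≤ η y
  eq_zero : ∀ y, 1 ≤ ‖y‖ → η y = 0
  pd_eq_zero : ∀ i y, 1 ≤ ‖y‖ → pd η i y = 0
  integral_eq : ∫ y, η y = 1
  le : ∀ y, η y ≤ c
  pd_le : ∀ i y, |pd η i y| ≤ c
  moment : ∀ g : Fin 3 → E3 → ℝ, (∀ j, ContDiff ℝ (⊤ : ℕ∞) (g j)) →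
    (∀ x, ∑ j, pd (g j) j x = 0) → ∀ (x : E3) (s : ℝ),
    ∫ y, η y * ∑ j, y j * g j (x - s • y) = 0

theorem IsMollifier.hasCompactSupport {η : E3 → ℝ} {c : ℝ} (h : IsMollifier η c) :
    HasCompactSupport η :=
  hasCompactSupport_of_eq_zero h.eq_zero

theorem IsMollifier.pos {η : E3 → ℝ} {c : ℝ} (h : IsMollifier η c) : 0 < c := by
  by_contra hc
  have h0 : ∀ y, η y = 0 := fun y => le_antisymm ((h.le y).trans (not_lt.1 hc)) (h.nonneg y)
  have := h.integral_eq
  simp [h0] at this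

/-- The profile `η₀ = 2 (deriv h) (1 - |y|²)`, for which `∇ (h(1 - |y|²)) = - y η₀`. -/
noncomputable def radialBump (y : E3) : ℝ :=
  2 * deriv Real.smoothTransition (1 - ‖y‖ ^ 2)

theorem pd_radialCutoff_zero_one (i : Fin 3) (y : E3) :
    pd (radialCutoff 0 1) i y = -(y i * radialBump y) := by
  rw [pd_radialCutoff, radialBump]
  norm_num
  ring

theorem smooth_radialBump : ContDiff ℝ (⊤ : ℕ∞) radialBump :=
  contDiff_const.mul
    (smooth_deriv_smoothTransition.comp (contDiff_const.sub (contDiff_norm_sq ℝ)))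

theorem radialBump_nonneg (y : E3) : 0 ≤ radialBump y :=
  mul_nonneg zero_le_two (deriv_smoothTransition_nonneg _)

theorem radialBump_eq_zero {y : E3} (hy : 1 ≤ ‖y‖) : radialBump y = 0 := by
  rw [radialBump, deriv_smoothTransition_of_nonpos (by nlinarith), mul_zero]

theorem integral_radialBump_pos : 0 < ∫ y, radialBump y := by
  have hc : HasCompactSupport radialBump :=
    hasCompactSupport_of_eq_zero fun y hy => radialBump_eq_zero hy
  refine lt_of_le_of_ne (integral_nonneg radialBump_nonneg) fun h => ?_
  have h1 : radialBump =ᵐ[volume] 0 :=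
    (integral_eq_zero_iff_of_nonneg radialBump_nonneg
      (smooth_radialBump.continuous.integrable_of_hasCompactSupport hc)).1 h.symm
  have h2 : radialBump = 0 :=
    (Continuous.ae_eq_iff_eq volume smooth_radialBump.continuous continuous_zero).1 h1
  have h3 : ∀ x, fderiv ℝ (radialCutoff 0 1) x = 0 := by
    intro x
    ext y
    rw [fderiv_apply_eq_sum_pd]
    simp [pd_radialCutoff_zero_one, h2]
  have h4 := is_const_of_fderiv_eq_zero (differentiable_of_smooth (smooth_radialCutoff 0 1)) h3
    0 (EuclideanSpace.single 0 1)
  rw [radialCutoff_eq_one le_rfl zero_lt_one (by simp),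
    radialCutoff_eq_zero le_rfl zero_lt_one (by simp)] at h4
  exact one_ne_zero h4

theorem pd_eq_zero_of_eq_zero {η : E3 → ℝ} (h0 : ∀ y, 0 ≤ η y)
    (i : Fin 3) {y : E3} (hy : η y = 0) : pd η i y = 0 := by
  have hmin : IsLocalMin η y := Filter.Eventually.of_forall fun s => by
    rw [hy]
    exact h0 s
  rw [pd, hmin.fderiv_eq_zero]
  simp

theorem radialBump_moment (g : Fin 3 → E3 → ℝ) (hg : ∀ j, ContDiff ℝ (⊤ : ℕ∞) (g j))
    (hdiv : ∀ x, ∑ j, pd (g j) j x = 0) (x : E3) (s : ℝ) :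
    ∫ y, radialBump y * ∑ j, y j * g j (x - s • y) = 0 := by
  have hc : HasCompactSupport (radialCutoff 0 1) :=
    hasCompactSupport_of_eq_zero fun y hy => radialCutoff_eq_zero le_rfl zero_lt_one hy
  have hG : ∀ j, ContDiff ℝ (⊤ : ℕ∞) fun y => g j (x - s • y) := fun j => smooth_shift (hg j) x s
  have h1 : ∀ j, ∫ y, pd (radialCutoff 0 1) j y * g j (x - s • y)
      = ∫ y, radialCutoff 0 1 y * (s * pd (g j) j (x - s • y)) := by
    intro j
    have h2 := integral_mul_pd_eq_neg (smooth_radialCutoff 0 1) (hG j) hc j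
    rw [eq_neg_iff_add_eq_zero, add_comm, ← eq_neg_iff_add_eq_zero] at h2
    rw [h2, ← integral_neg]
    refine integral_congr_ae (Filter.Eventually.of_forall fun y => ?_)
    simp only [pd_shift (differentiable_of_smooth (hg j))]
    ring
  have hi1 : ∀ j ∈ Finset.univ,
      Integrable (fun y => pd (radialCutoff 0 1) j y * g j (x - s • y)) := fun j _ =>
    ((continuous_pd (smooth_radialCutoff 0 1) j).mul (hG j).continuous).integrable_of_hasCompactSupport
      ((hc.fderiv_apply ℝ _).mul_right)
  have hi2 : ∀ j ∈ Finset.univ,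
      Integrable (fun y => radialCutoff 0 1 y * (s * pd (g j) j (x - s • y))) := fun j _ =>
    ((smooth_radialCutoff 0 1).continuous.mul (continuous_const.mul
      (smooth_shift (smooth_pd (hg j) j) x s).continuous)).integrable_of_hasCompactSupport
      hc.mul_right
  calc ∫ y, radialBump y * ∑ j, y j * g j (x - s • y)
      = -∫ y, ∑ j, pd (radialCutoff 0 1) j y * g j (x - s • y) := by
        rw [← integral_neg]
        congr 1 with y
        rw [Finset.mul_sum, ← Finset.sum_neg_distrib]
        refine Finset.sum_congr rfl fun j _ => ?_
        rw [pd_radialCutoff_zero_one]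
        ring
    _ = -∫ y, ∑ j, radialCutoff 0 1 y * (s * pd (g j) j (x - s • y)) := by
        rw [integral_finsetSum _ hi1, integral_finsetSum _ hi2]
        simp only [h1]
    _ = 0 := by
        simp [← Finset.mul_sum, hdiv]

theorem exists_isMollifier : ∃ η c, IsMollifier η c := by
  set I := ∫ y, radialBump y with hI
  have hI0 : 0 < I := integral_radialBump_pos
  set η : E3 → ℝ := fun y => I⁻¹ * radialBump y with hη
  have hs : ContDiff ℝ (⊤ : ℕ∞) η := contDiff_const.mul smooth_radialBump
  have h0 : ∀ y, 0 ≤ η y := fun y => mul_nonneg (inv_nonneg.2 hI0.le) (radialBump_nonneg y)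
  have hz : ∀ y, 1 ≤ ‖y‖ → η y = 0 := fun y hy => by simp [hη, radialBump_eq_zero hy]
  have hc : HasCompactSupport η := hasCompactSupport_of_eq_zero hz
  obtain ⟨c, hcb⟩ := hs.continuous.bounded_above_of_compact_support hc
  have hp : ∀ i, ∃ c, ∀ y, ‖pd η i y‖ ≤ c := fun i =>
    (continuous_pd hs i).bounded_above_of_compact_support (hc.fderiv_apply ℝ _)
  choose d hd using hp
  refine ⟨η, max c (max (d 0) (max (d 1) (d 2))), hs, h0, hz,
    fun i y hy => pd_eq_zero_of_eq_zero h0 i (hz y hy), ?_, ?_, ?_, ?_⟩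
  · simp only [hη]
    rw [integral_const_mul, ← hI, inv_mul_cancel₀ hI0.ne']
  · exact fun y => (le_abs_self _).trans ((hcb y).trans (le_max_left _ _))
  · intro i y
    refine (hd i y).trans ?_
    fin_cases i <;> simp
  · intro g hg hdiv x s
    simp only [hη, mul_assoc]
    rw [integral_const_mul, radialBump_moment g hg hdiv, mul_zero]


/-! ### Mollification of fields with a potential of bounded mean oscillation -/

theorem Continuous.integrableOn_ball_E3 {F : Type*} [NormedAddCommGroup F] {f : E3 → F}
    (hf : Continuous f) (z : E3) (r : ℝ) : IntegrableOn f (Metric.ball z r) :=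
  (hf.continuousOn.integrableOn_compact (isCompact_closedBall z r)).mono_set
    Metric.ball_subset_closedBall

theorem Continuous.integrableOn_closedBall_E3 {F : Type*} [NormedAddCommGroup F] {f : E3 → F}
    (hf : Continuous f) (z : E3) (r : ℝ) : IntegrableOn f (Metric.closedBall z r) :=
  hf.continuousOn.integrableOn_compact (isCompact_closedBall z r)

theorem setIntegral_ball_comp_sub_smul (g : E3 → ℝ) (x : E3) {ε : ℝ} (hε : 0 < ε) :
    ∫ y in Metric.ball (0 : E3) 1, g (x - ε • y)
      = volume.real (Metric.ball (0 : E3) 1) * ⨍ z in Metric.ball x ε, g z := by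
  have h1 : ∀ y : E3, (Metric.ball (0 : E3) 1).indicator (fun y => g (x - ε • y)) y
      = (fun z => (Metric.ball x ε).indicator g (x - z)) (ε • y) := by
    intro y
    have : y ∈ Metric.ball (0 : E3) 1 ↔ x - ε • y ∈ Metric.ball x ε := by
      rw [mem_ball_zero_iff, Metric.mem_ball, dist_eq_norm, sub_sub_cancel_left, norm_neg,
        norm_smul, Real.norm_of_nonneg hε.le]
      constructor <;> intro h <;> nlinarith
    change _ = (Metric.ball x ε).indicator g (x - ε • y)
    by_cases hy : y ∈ Metric.ball (0 : E3) 1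
    · rw [Set.indicator_of_mem hy, Set.indicator_of_mem (this.1 hy)]
    · rw [Set.indicator_of_notMem hy, Set.indicator_of_notMem (mt this.2 hy)]
  rw [← integral_indicator measurableSet_ball]
  simp only [h1]
  rw [Measure.integral_comp_smul volume (fun z => (Metric.ball x ε).indicator g (x - z)) ε,
    integral_sub_left_eq_self (fun z => (Metric.ball x ε).indicator g z) volume x,
    integral_indicator measurableSet_ball, setAverage_eq,
    ← Measure.addHaar_real_closedBall_eq_addHaar_real_ball volume x ε,
    Measure.addHaar_real_closedBall volume x hε.le]
  have hb : volume.real (Metric.ball (0 : E3) 1) ≠ 0 :=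
    (ENNReal.toReal_pos (Metric.measure_ball_pos volume _ one_pos).ne'
      measure_ball_lt_top.ne).ne'
  simp only [finrank_euclideanSpace, Fintype.card_fin, smul_eq_mul, mul_inv]
  rw [abs_of_pos (by positivity)]
  field_simp

theorem IsMollifier.abs_integral_pd_mul_le {η : E3 → ℝ} {c : ℝ} (h : IsMollifier η c)
    {f : E3 → ℝ} (hf : Continuous f) (x : E3) {ε : ℝ} (hε : 0 < ε) (i : Fin 3) :
    |∫ y, pd η i y * f (x - ε • y)|
      ≤ c * volume.real (Metric.ball (0 : E3) 1) * ⨍ z in Metric.ball x ε, |f z| := by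
  have hsupp : ∀ y, y ∉ Metric.ball (0 : E3) 1 → pd η i y * f (x - ε • y) = 0 := by
    intro y hy
    rw [mem_ball_zero_iff, not_lt] at hy
    rw [h.pd_eq_zero i y hy, zero_mul]
  rw [← setIntegral_eq_integral_of_forall_compl_eq_zero hsupp, mul_assoc,
    ← setIntegral_ball_comp_sub_smul (fun z => |f z|) x hε, ← integral_const_mul]
  have hcont : Continuous fun y => f (x - ε • y) := by fun_prop
  rw [← Real.norm_eq_abs]
  refine norm_integral_le_of_norm_le ?_ (Filter.Eventually.of_forall fun y => ?_)
  · exact (continuous_const.mul hcont.abs).integrableOn_ball_E3 0 1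
  · rw [Real.norm_eq_abs, abs_mul]
    exact mul_le_mul_of_nonneg_right (h.pd_le i y) (abs_nonneg _)

theorem IsBMO.exists_abs_mollified_le {η : E3 → ℝ} {c : ℝ} (h : IsMollifier η c)
    {Φ : E3 → Fin 3 → Fin 3 → ℝ} (hΦ : ContDiff ℝ (⊤ : ℕ∞) Φ) (hBMO : IsBMO Φ) :
    ∃ κ : ℝ, 0 < κ ∧ ∀ (j : Fin 3) (x : E3) (ε : ℝ), 0 < ε →
      |∫ y, η y * matDiv Φ (x - ε • y) j| ≤ κ / ε := by
  obtain ⟨K, hK⟩ := hBMO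
  set b := volume.real (Metric.ball (0 : E3) 1) with hb
  have hb0 : 0 ≤ b := measureReal_nonneg
  have hc := h.pos
  refine ⟨3 * (c * b * |K|) + 1, by positivity, fun j x ε hε => ?_⟩
  have hs : ∀ i, ContDiff ℝ (⊤ : ℕ∞) fun y => Φ y i j := fun i =>
    contDiff_pi.1 (contDiff_pi.1 hΦ i) j
  set m : Fin 3 → Fin 3 → ℝ := fun i j => ⨍ y in Metric.ball x ε, Φ y i j with hm
  have hosc : ∀ i, ⨍ z in Metric.ball x ε, |Φ z i j - m i j| ≤ |K| := by
    intro i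
    refine le_trans ?_ ((hK x ε hε).trans (le_abs_self K))
    rw [setAverage_eq, setAverage_eq]
    refine smul_le_smul_of_nonneg_left ?_ (inv_nonneg.2 measureReal_nonneg)
    have hcont : Continuous fun y => (fun (i j : Fin 3) => Φ y i j - m i j) := by
      have := hΦ.continuous
      fun_prop
    refine integral_mono ?_ ?_ fun y => ?_
    · exact ((hs i).continuous.sub continuous_const).abs.integrableOn_ball_E3 x ε
    · exact hcont.norm.integrableOn_ball_E3 x ε
    · exact (norm_le_pi_norm (fun j => Φ y i j - m i j) j).trans
        (norm_le_pi_norm (fun (i j : Fin 3) => Φ y i j - m i j) i)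
  have hterm : ∀ i, |∫ y, η y * pd (fun z => Φ z i j) i (x - ε • y)| ≤ ε⁻¹ * (c * b * |K|) := by
    intro i
    have h1 := integral_mul_pd_shift h.smooth ((hs i).sub contDiff_const) h.hasCompactSupport
      hε.ne' i x (f := fun z => Φ z i j - m i j)
    simp only [pd_sub_const] at h1
    rw [h1, abs_mul, abs_of_pos (inv_pos.2 hε)]
    refine mul_le_mul_of_nonneg_left ?_ (inv_pos.2 hε).le
    refine (h.abs_integral_pd_mul_le ((hs i).continuous.sub continuous_const) x hε i).trans ?_
    exact mul_le_mul_of_nonneg_left (hosc i) (by positivity)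
  have hsum : ∫ y, η y * matDiv Φ (x - ε • y) j
      = ∑ i, ∫ y, η y * pd (fun z => Φ z i j) i (x - ε • y) := by
    rw [← integral_finsetSum]
    · simp only [matDiv, Finset.mul_sum]
    · intro i _
      exact (h.smooth.continuous.mul (smooth_shift (smooth_pd (hs i) i) x ε).continuous
        ).integrable_of_hasCompactSupport h.hasCompactSupport.mul_right
  rw [hsum]
  calc _ ≤ ∑ i : Fin 3, ε⁻¹ * (c * b * |K|) :=
        (Finset.abs_sum_le_sum_abs _ _).trans (Finset.sum_le_sum fun i _ => hterm i)
    _ = 3 * (c * b * |K|) / ε := by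
        simp only [Finset.sum_const, Finset.card_univ, Fintype.card_fin, nsmul_eq_mul]
        push_cast
        ring
    _ ≤ _ := by gcongr; linarith


/-! ### Averages over translates -/

theorem lintegral_shift_le {Y : Type*} [MeasurableSpace Y] (ν : Measure Y) [SFinite ν]
    {G : E3 → ENNReal} (hG : Measurable G) {h : Y → E3} (hh : Measurable h) {a δ : ℝ}
    (hδ : ∀ᵐ y ∂ν, ‖h y‖ ≤ δ) :
    ∫⁻ x in Metric.closedBall 0 a, ∫⁻ y, G (x - h y) ∂ν
      ≤ ν Set.univ * ∫⁻ x in Metric.closedBall 0 (a + δ), G x := by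
  rw [lintegral_lintegral_swap (by
    refine Measurable.aemeasurable ?_
    exact hG.comp (measurable_fst.sub (hh.comp measurable_snd)))]
  rw [mul_comm, ← lintegral_const]
  refine lintegral_mono_ae (hδ.mono fun y hy => ?_)
  rw [← lintegral_indicator measurableSet_closedBall, ← lintegral_indicator measurableSet_closedBall,
    ← lintegral_sub_right_eq_self
      (fun x => (Metric.closedBall 0 (a + δ)).indicator G x) (h y)]
  refine lintegral_mono fun x => ?_
  by_cases hx : x ∈ Metric.closedBall (0 : E3) a
  · have hx' : x - h y ∈ Metric.closedBall (0 : E3) (a + δ) := by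
      rw [mem_closedBall_zero_iff] at hx ⊢
      exact (norm_sub_le _ _).trans (add_le_add hx hy)
    rw [Set.indicator_of_mem hx, Set.indicator_of_mem hx']
  · rw [Set.indicator_of_notMem hx]
    exact zero_le

theorem abs_integral_le_of_averages {Y : Type*} [MeasurableSpace Y] (ν : Measure Y)
    [IsFiniteMeasure ν] {G : E3 → ℝ} (hG : Continuous G) (hG0 : ∀ x, 0 ≤ G x)
    {h : Y → E3} (hh : Measurable h) {a δ : ℝ} (hδ0 : 0 ≤ δ) (hδ : ∀ᵐ y ∂ν, ‖h y‖ ≤ δ)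
    {f : E3 → ℝ} (hf : ∀ x, a < ‖x‖ → f x = 0) {α β γ : ℝ} (hα : 0 ≤ α) (hβ : 0 ≤ β) (hγ : 0 ≤ γ)
    (hb : ∀ x, ‖x‖ ≤ a → |f x| ≤ α * G x + β * ∫ y, G (x - h y) ∂ν + γ) :
    |∫ x, f x| ≤ (α + β * ν.real Set.univ) * (∫ x in Metric.closedBall 0 (a + δ), G x)
      + γ * volume.real (Metric.closedBall (0 : E3) a) := by
  have hGi : IntegrableOn G (Metric.closedBall 0 (a + δ)) := hG.integrableOn_closedBall_E3 0 _
  have hI0 : 0 ≤ ∫ x in Metric.closedBall 0 (a + δ), G x := integral_nonneg hG0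
  have hgm : Measurable fun x => ENNReal.ofReal (G x) := hG.measurable.ennreal_ofReal
  have hI : ENNReal.ofReal (∫ x in Metric.closedBall 0 (a + δ), G x)
      = ∫⁻ x in Metric.closedBall 0 (a + δ), ENNReal.ofReal (G x) :=
    ofReal_integral_eq_lintegral_ofReal hGi (Filter.Eventually.of_forall hG0)
  rw [← ENNReal.ofReal_le_ofReal_iff (by positivity), ← Real.norm_eq_abs, ofReal_norm]
  have hf' : ∀ x, x ∉ Metric.closedBall (0 : E3) a → f x = 0 := fun x hx =>
    hf x (by simpa using hx)
  have hpt : ∀ x ∈ Metric.closedBall (0 : E3) a, ‖f x‖ₑ ≤ ENNReal.ofReal α * ENNReal.ofReal (G x)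
      + ENNReal.ofReal β * ∫⁻ y, ENNReal.ofReal (G (x - h y)) ∂ν + ENNReal.ofReal γ := by
    intro x hx
    have hint : ENNReal.ofReal (∫ y, G (x - h y) ∂ν) ≤ ∫⁻ y, ENNReal.ofReal (G (x - h y)) ∂ν := by
      have h1 := enorm_integral_le_lintegral_enorm (μ := ν) fun y => G (x - h y)
      have h2 : 0 ≤ ∫ y, G (x - h y) ∂ν := integral_nonneg fun y => hG0 _
      simpa only [Real.enorm_of_nonneg h2, Real.enorm_of_nonneg (hG0 _)] using h1
    have h2 : 0 ≤ ∫ y, G (x - h y) ∂ν := integral_nonneg fun y => hG0 _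
    rw [← ofReal_norm, Real.norm_eq_abs]
    refine (ENNReal.ofReal_le_ofReal (hb x (by simpa using hx))).trans ?_
    rw [ENNReal.ofReal_add (by have := hG0 x; positivity) hγ,
      ENNReal.ofReal_add (mul_nonneg hα (hG0 x)) (by positivity), ENNReal.ofReal_mul hα,
      ENNReal.ofReal_mul hβ]
    gcongr
  rw [← setIntegral_eq_integral_of_forall_compl_eq_zero hf']
  calc ‖∫ x in Metric.closedBall 0 a, f x‖ₑ
      ≤ ∫⁻ x in Metric.closedBall 0 a, ‖f x‖ₑ := enorm_integral_le_lintegral_enorm _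
    _ ≤ ∫⁻ x in Metric.closedBall 0 a, (ENNReal.ofReal α * ENNReal.ofReal (G x)
      + ENNReal.ofReal β * ∫⁻ y, ENNReal.ofReal (G (x - h y)) ∂ν + ENNReal.ofReal γ) :=
        setLIntegral_mono' measurableSet_closedBall hpt
    _ = ENNReal.ofReal α * (∫⁻ x in Metric.closedBall 0 a, ENNReal.ofReal (G x))
      + ENNReal.ofReal β *
        (∫⁻ x in Metric.closedBall 0 a, ∫⁻ y, ENNReal.ofReal (G (x - h y)) ∂ν)
      + ENNReal.ofReal γ * volume (Metric.closedBall (0 : E3) a) := by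
        rw [lintegral_add_right _ measurable_const, lintegral_add_left (hgm.const_mul _),
          lintegral_const_mul _ hgm, lintegral_const_mul, setLIntegral_const]
        exact Measurable.lintegral_prod_right
          (hgm.comp (measurable_fst.sub (hh.comp measurable_snd)))
    _ ≤ ENNReal.ofReal α * (∫⁻ x in Metric.closedBall 0 (a + δ), ENNReal.ofReal (G x))
      + ENNReal.ofReal β *
        (ν Set.univ * ∫⁻ x in Metric.closedBall 0 (a + δ), ENNReal.ofReal (G x))
      + ENNReal.ofReal γ * volume (Metric.closedBall (0 : E3) a) := by
        gcongr ?_ + ?_ + _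
        · refine mul_le_mul_right ?_ _
          exact lintegral_mono_set (Metric.closedBall_subset_closedBall (by linarith))
        · exact mul_le_mul_right (lintegral_shift_le ν hgm hh hδ) _
    _ = _ := by
        rw [← hI, ENNReal.ofReal_add (by positivity) (by positivity), add_mul,
          ENNReal.ofReal_add (by positivity) (by positivity), ENNReal.ofReal_mul hα,
          ENNReal.ofReal_mul (by positivity), ENNReal.ofReal_mul hβ, ENNReal.ofReal_mul hγ,
          ofReal_measureReal, ofReal_measureReal measure_closedBall_lt_top.ne, mul_assoc]

/-- Lebesgue measure on `[0, 1] × B̄₁`, the parameter space for segments `x - σ c y`. -/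
noncomputable def segMeasure : Measure (ℝ × E3) :=
  (volume.restrict (Set.Icc (0 : ℝ) 1)).prod (volume.restrict (Metric.closedBall (0 : E3) 1))

instance : IsFiniteMeasure (volume.restrict (Metric.closedBall (0 : E3) 1)) :=
  ⟨by simp⟩

instance : IsFiniteMeasure segMeasure := by
  unfold segMeasure
  infer_instance

theorem segMeasure_univ : segMeasure Set.univ = volume (Metric.closedBall (0 : E3) 1) := by
  rw [segMeasure, ← Set.univ_prod_univ, Measure.prod_prod]
  simp

theorem segMeasure_real_univ :
    segMeasure.real Set.univ = volume.real (Metric.closedBall (0 : E3) 1) := by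
  rw [measureReal_def, segMeasure_univ, measureReal_def]

theorem segMeasure_eq_restrict :
    segMeasure = volume.restrict (Set.Icc (0 : ℝ) 1 ×ˢ Metric.closedBall (0 : E3) 1) := by
  rw [segMeasure, Measure.prod_restrict]
  rfl

theorem ae_segMeasure : ∀ᵐ q ∂segMeasure, (0 ≤ q.1 ∧ q.1 ≤ 1) ∧ ‖q.2‖ ≤ 1 := by
  rw [segMeasure_eq_restrict]
  filter_upwards [ae_restrict_mem (measurableSet_Icc.prod measurableSet_closedBall)] with q hq
  exact ⟨hq.1, by simpa using hq.2⟩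

theorem norm_segShift_le {c : ℝ} (hc : 0 ≤ c) :
    ∀ᵐ q ∂segMeasure, ‖(q.1 * c) • q.2‖ ≤ c := by
  filter_upwards [ae_segMeasure] with q hq
  rw [norm_smul, Real.norm_of_nonneg (mul_nonneg hq.1.1 hc)]
  have h1 := hq.1.1
  have h2 := hq.1.2
  calc q.1 * c * ‖q.2‖ ≤ 1 * c * 1 := by
        gcongr
        exact hq.2
    _ = c := by ring

theorem Continuous.integrable_segMeasure {F : ℝ × E3 → ℝ} (hF : Continuous F) :
    Integrable F segMeasure := by
  rw [segMeasure_eq_restrict]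
  exact hF.continuousOn.integrableOn_compact (isCompact_Icc.prod (isCompact_closedBall _ _))

theorem IsMollifier.setIntegral_eq {η : E3 → ℝ} {c : ℝ} (h : IsMollifier η c) (f : E3 → ℝ) :
    ∫ y in Metric.closedBall (0 : E3) 1, η y * f y = ∫ y, η y * f y := by
  refine setIntegral_eq_integral_of_forall_compl_eq_zero fun y hy => ?_
  rw [mem_closedBall_zero_iff, not_le] at hy
  rw [h.eq_zero y hy.le, zero_mul]

/-- The difference between a function and its mollification, as an average of derivatives. -/
theorem IsMollifier.sub_mollified_eq {η : E3 → ℝ} {c₀ : ℝ} (h : IsMollifier η c₀) {f : E3 → ℝ}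
    (hf : ContDiff ℝ (⊤ : ℕ∞) f) (c : ℝ) (x : E3) :
    f x - ∫ y, η y * f (x - c • y)
      = ∫ q, η q.2 * (c * ∑ i, q.2 i * pd f i (x - (q.1 * c) • q.2)) ∂segMeasure := by
  have hη := h.smooth.continuous
  have hcont : Continuous fun q : ℝ × E3 =>
      η q.2 * (c * ∑ i, q.2 i * pd f i (x - (q.1 * c) • q.2)) := by
    have := fun i => continuous_pd hf i
    fun_prop
  have hinner : ∀ y : E3, ∫ σ in Set.Icc (0 : ℝ) 1,
      η y * (c * ∑ i, y i * pd f i (x - (σ * c) • y)) = η y * (f x - f (x - c • y)) := by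
    intro y
    rw [integral_Icc_eq_integral_Ioc, ← intervalIntegral.integral_of_le zero_le_one]
    have hd : ∀ σ ∈ Set.uIcc (0 : ℝ) 1, HasDerivAt (fun σ : ℝ => -(η y * f (x - (σ * c) • y)))
        (η y * (c * ∑ i, y i * pd f i (x - (σ * c) • y))) σ := by
      intro σ _
      have h1 : HasDerivAt (fun σ : ℝ => x - (σ * c) • y) (-((1 * c) • y)) σ :=
        (((hasDerivAt_id σ).mul_const c).smul_const y).const_sub x
      have h2 := ((differentiable_of_smooth hf (x - (σ * c) • y)).hasFDerivAt.comp_hasDerivAt σ h1)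
      refine (h2.const_mul (η y)).neg.congr_deriv ?_
      rw [map_neg, one_mul, map_smul, fderiv_apply_eq_sum_pd, smul_eq_mul]
      ring
    rw [intervalIntegral.integral_eq_sub_of_hasDerivAt hd]
    · simp
      ring
    · refine Continuous.intervalIntegrable ?_ _ _
      exact hcont.comp (continuous_id.prodMk continuous_const)
  have hint := hcont.integrable_segMeasure
  unfold segMeasure at hint ⊢
  rw [integral_prod_symm _ hint]
  simp only [hinner]
  rw [h.setIntegral_eq fun y => f x - f (x - c • y)]
  have hi1 : Integrable fun y => η y * f x :=
    (hη.mul continuous_const).integrable_of_hasCompactSupport h.hasCompactSupport.mul_right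
  have hi2 : Integrable fun y => η y * f (x - c • y) :=
    (hη.mul (smooth_shift hf x c).continuous).integrable_of_hasCompactSupport
      h.hasCompactSupport.mul_right
  simp only [mul_sub]
  rw [integral_sub hi1 hi2, integral_mul_const, h.integral_eq, one_mul]


/-! ### A local interpolation inequality -/

theorem IsMollifier.abs_sub_mollified_le {η : E3 → ℝ} {c₀ : ℝ} (h : IsMollifier η c₀) {f : E3 → ℝ}
    {ε : ℝ} (hε : 0 ≤ ε) (x : E3) {q : ℝ × E3} (hq : ‖q.2‖ ≤ 1) :
    |η q.2 * (ε * ∑ i, q.2 i * pd f i (x - (q.1 * ε) • q.2))|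
      ≤ c₀ * ε * ∑ i, |pd f i (x - (q.1 * ε) • q.2)| := by
  rw [abs_mul, abs_mul, abs_of_nonneg (h.nonneg _), abs_of_nonneg hε, mul_assoc]
  refine mul_le_mul (h.le _) (mul_le_mul_of_nonneg_left ?_ hε) (by positivity) h.pos.le
  refine (Finset.abs_sum_le_sum_abs _ _).trans (Finset.sum_le_sum fun i _ => ?_)
  rw [abs_mul]
  exact mul_le_of_le_one_left (abs_nonneg _) ((abs_coord_le_norm _ _).trans hq)

theorem volume_closedBall_one_eq :
    volume (Metric.closedBall (0 : E3) 1)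
      = ENNReal.ofReal (volume.real (Metric.closedBall (0 : E3) 1)) :=
  (ofReal_measureReal measure_closedBall_lt_top.ne).symm

theorem volume_real_closedBall_pos : 0 < volume.real (Metric.closedBall (0 : E3) 1) :=
  ENNReal.toReal_pos (Metric.measure_closedBall_pos volume _ one_pos).ne' measure_closedBall_lt_top.ne

theorem IsMollifier.levelSet_le {η : E3 → ℝ} {c₀ : ℝ} (h : IsMollifier η c₀) {g : E3 → ℝ}
    (hg : ContDiff ℝ (⊤ : ℕ∞) g) {κ : ℝ} (hκ : 0 < κ)
    (hm : ∀ x ε, 0 < ε → |∫ y, η y * g (x - ε • y)| ≤ κ / ε) {s d t : ℝ} (hd : 0 < d)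
    (ht : κ / d < t) :
    ENNReal.ofReal (t ^ 2) * volume.restrict (Metric.closedBall (0 : E3) s) {x | t < |g x| / 2}
      ≤ ENNReal.ofReal (2 * c₀ * volume.real (Metric.closedBall (0 : E3) 1) * κ)
        * ∫⁻ x in Metric.closedBall (0 : E3) (s + d),
          {x | t ^ 2 < 2 * c₀ * volume.real (Metric.closedBall (0 : E3) 1) * κ
            * ∑ i, |pd g i x|}.indicator (fun x => ENNReal.ofReal (∑ i, |pd g i x|)) x := by
  set b := volume.real (Metric.closedBall (0 : E3) 1) with hb
  have hb0 : 0 < b := volume_real_closedBall_pos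
  have hc := h.pos
  have ht0 : 0 < t := lt_trans (by positivity) ht
  set m : E3 → ℝ := fun x => ∑ i, |pd g i x| with hmdef
  have hmc : Continuous m := continuous_finsetSum _ fun i _ => (continuous_pd hg i).abs
  set G : E3 → ENNReal := {x | t ^ 2 < 2 * c₀ * b * κ * m x}.indicator
    (fun x => ENNReal.ofReal (m x)) with hG
  have hGm : Measurable G := (hmc.measurable.ennreal_ofReal).indicator
    (measurableSet_lt measurable_const (hmc.measurable.const_mul _))
  set ε := κ / t with hε
  have hε0 : 0 < ε := by positivity
  have hεd : ε ≤ d := by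
    rw [hε, div_le_iff₀ ht0]
    rw [div_lt_iff₀ hd] at ht
    linarith
  have hh : Measurable fun q : ℝ × E3 => (q.1 * ε) • q.2 := by fun_prop
  set A := Metric.closedBall (0 : E3) s ∩ {x | t < |g x| / 2} with hA
  have hAm : MeasurableSet A := measurableSet_closedBall.inter
    (measurableSet_lt measurable_const (hg.continuous.measurable.abs.div_const _))
  have hmT : ∀ x, ENNReal.ofReal (m x) ≤ ENNReal.ofReal (t ^ 2 / (2 * c₀ * b * κ)) + G x := by
    intro x
    by_cases hx : t ^ 2 < 2 * c₀ * b * κ * m x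
    · rw [hG, Set.indicator_of_mem (by exact hx)]
      exact le_add_self
    · refine le_trans (ENNReal.ofReal_le_ofReal ?_) le_self_add
      rw [le_div_iff₀ (by positivity)]
      linarith
  have hpt : ∀ x ∈ A, ENNReal.ofReal (t ^ 2)
      ≤ ENNReal.ofReal (2 * c₀ * κ) * ∫⁻ q, G (x - (q.1 * ε) • q.2) ∂segMeasure := by
    rintro x ⟨-, hx⟩
    change t < |g x| / 2 at hx
    have h1 : t ≤ |g x - ∫ y, η y * g (x - ε • y)| := by
      have h2 := hm x ε hε0
      have h3 : κ / ε = t := by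
        rw [hε]
        field_simp
      have h4 := abs_sub_abs_le_abs_sub (g x) (∫ y, η y * g (x - ε • y))
      linarith
    rw [h.sub_mollified_eq hg] at h1
    have h5 : ENNReal.ofReal t ≤ ENNReal.ofReal (c₀ * ε) *
        (ENNReal.ofReal (t ^ 2 / (2 * c₀ * b * κ)) * ENNReal.ofReal b
          + ∫⁻ q, G (x - (q.1 * ε) • q.2) ∂segMeasure) := by
      refine (ENNReal.ofReal_le_ofReal h1).trans ?_
      rw [← Real.norm_eq_abs, ofReal_norm]
      refine (enorm_integral_le_lintegral_enorm _).trans ?_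
      rw [hb, ← volume_closedBall_one_eq, ← segMeasure_univ, ← lintegral_const,
        ← lintegral_add_left measurable_const, ← lintegral_const_mul' _ _ ENNReal.ofReal_ne_top]
      refine lintegral_mono_ae (ae_segMeasure.mono fun q hq => ?_)
      rw [← ofReal_norm, Real.norm_eq_abs]
      refine (ENNReal.ofReal_le_ofReal (h.abs_sub_mollified_le hε0.le x hq.2)).trans ?_
      rw [ENNReal.ofReal_mul (by positivity)]
      exact mul_le_mul_right (hmT _) _
    rw [mul_add, ← ENNReal.ofReal_mul (by positivity), ← ENNReal.ofReal_mul (by positivity)] at h5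
    have h6 : c₀ * ε * (t ^ 2 / (2 * c₀ * b * κ) * b) = t / 2 := by
      rw [hε]
      field_simp
    have h7 : ENNReal.ofReal t = ENNReal.ofReal (t / 2) + ENNReal.ofReal (t / 2) := by
      rw [← ENNReal.ofReal_add (by positivity) (by positivity), add_halves]
    rw [h6, h7, ENNReal.add_le_add_iff_left ENNReal.ofReal_ne_top] at h5
    calc ENNReal.ofReal (t ^ 2) = ENNReal.ofReal (2 * t) * ENNReal.ofReal (t / 2) := by
          rw [← ENNReal.ofReal_mul (by positivity)]
          congr 1
          ring
      _ ≤ ENNReal.ofReal (2 * t) * (ENNReal.ofReal (c₀ * ε)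
          * ∫⁻ q, G (x - (q.1 * ε) • q.2) ∂segMeasure) := mul_le_mul_right h5 _
      _ = _ := by
          rw [← mul_assoc, ← ENNReal.ofReal_mul (by positivity)]
          congr 2
          rw [hε]
          field_simp
  rw [Measure.restrict_apply' measurableSet_closedBall, Set.inter_comm, ← setLIntegral_const]
  calc ∫⁻ _ in A, ENNReal.ofReal (t ^ 2)
      ≤ ∫⁻ x in A, ENNReal.ofReal (2 * c₀ * κ) * ∫⁻ q, G (x - (q.1 * ε) • q.2) ∂segMeasure :=
        setLIntegral_mono' hAm hpt
    _ ≤ ∫⁻ x in Metric.closedBall (0 : E3) s, ENNReal.ofReal (2 * c₀ * κ)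
          * ∫⁻ q, G (x - (q.1 * ε) • q.2) ∂segMeasure :=
        lintegral_mono_set Set.inter_subset_left
    _ ≤ ENNReal.ofReal (2 * c₀ * κ) * (segMeasure Set.univ
          * ∫⁻ x in Metric.closedBall 0 (s + d), G x) := by
        rw [lintegral_const_mul' _ _ ENNReal.ofReal_ne_top]
        refine mul_le_mul_right (lintegral_shift_le segMeasure hGm hh ?_) _
        exact (norm_segShift_le hε0.le).mono fun q hq => hq.trans hεd
    _ = _ := by
        rw [segMeasure_univ, volume_closedBall_one_eq, ← hb, ← mul_assoc,
          ← ENNReal.ofReal_mul (by positivity)]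
        congr 2
        ring

theorem lintegral_Ioi_indicator_le {K M : ℝ} (hM : 0 ≤ K * M) :
    ∫⁻ t in Set.Ioi (0 : ℝ), {t : ℝ | t ^ 2 < K * M}.indicator (fun t => ENNReal.ofReal t) t
      ≤ ENNReal.ofReal (K * M) := by
  have h1 : ∀ t ∈ Set.Ioi (0 : ℝ),
      {t : ℝ | t ^ 2 < K * M}.indicator (fun t => ENNReal.ofReal t) t
        ≤ (Set.Ioo (0 : ℝ) √(K * M)).indicator (fun _ => ENNReal.ofReal √(K * M)) t := by
    intro t ht
    by_cases h : t ^ 2 < K * M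
    · have h2 : t < √(K * M) := Real.lt_sqrt_of_sq_lt h
      rw [Set.indicator_of_mem (by exact h), Set.indicator_of_mem (Set.mem_Ioo.2 ⟨ht, h2⟩)]
      exact ENNReal.ofReal_le_ofReal h2.le
    · rw [Set.indicator_of_notMem (by exact h)]
      exact zero_le
  refine (setLIntegral_mono' measurableSet_Ioi h1).trans ((setLIntegral_le_lintegral _ _).trans ?_)
  rw [lintegral_indicator measurableSet_Ioo, setLIntegral_const, Real.volume_Ioo, sub_zero,
    ← ENNReal.ofReal_mul (Real.sqrt_nonneg _), Real.mul_self_sqrt hM]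

theorem IsMollifier.lintegral_pow_four_le {η : E3 → ℝ} {c₀ : ℝ} (h : IsMollifier η c₀)
    {g : E3 → ℝ} (hg : ContDiff ℝ (⊤ : ℕ∞) g) {κ : ℝ} (hκ : 0 < κ)
    (hm : ∀ x ε, 0 < ε → |∫ y, η y * g (x - ε • y)| ≤ κ / ε) {s d : ℝ} (hd : 0 < d) {K : ℝ}
    (hK : K = 2 * c₀ * volume.real (Metric.closedBall (0 : E3) 1) * κ) :
    ∫⁻ x in Metric.closedBall (0 : E3) s, ENNReal.ofReal (g x ^ 4)
      ≤ ENNReal.ofReal (64 * (κ / d) ^ 4) * volume (Metric.closedBall (0 : E3) s)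
        + ∫⁻ x in Metric.closedBall (0 : E3) (s + d),
          ENNReal.ofReal (64 * K ^ 2 * (∑ i, |pd g i x|) ^ 2) := by
  have hb0 := volume_real_closedBall_pos
  have hc := h.pos
  have hK0 : 0 < K := by rw [hK]; positivity
  set m : E3 → ℝ := fun x => ∑ i, |pd g i x| with hmdef
  have hmc : Continuous m := continuous_finsetSum _ fun i _ => (continuous_pd hg i).abs
  have hm0 : ∀ x, 0 ≤ m x := fun x => Finset.sum_nonneg fun i _ => abs_nonneg _
  set μ := volume.restrict (Metric.closedBall (0 : E3) s) with hμ
  set ρ := volume.restrict (Metric.closedBall (0 : E3) (s + d)) with hρ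
  have hlayer := lintegral_comp_eq_lintegral_meas_lt_mul μ (f := fun x => |g x| / 2)
    (g := fun t => 64 * t ^ 3)
    (Filter.Eventually.of_forall fun x => by change (0 : ℝ) ≤ |g x| / 2; positivity)
    (hg.continuous.abs.div_const _).aemeasurable
    (fun t _ => (by fun_prop : Continuous fun t : ℝ => 64 * t ^ 3).intervalIntegrable _ _)
    ((ae_restrict_mem measurableSet_Ioi).mono fun t ht => by
      have : (0 : ℝ) < t := ht
      positivity)
  have hpow : ∀ x, ∫ t in (0 : ℝ)..(|g x| / 2), 64 * t ^ 3 = g x ^ 4 := by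
    intro x
    rw [intervalIntegral.integral_const_mul, integral_pow, ← (by decide : Even 4).pow_abs (g x)]
    norm_num
    ring
  simp only [hpow] at hlayer
  rw [hlayer]
  have hint : ∀ t ∈ Set.Ioi (0 : ℝ), μ {x | t < |g x| / 2} * ENNReal.ofReal (64 * t ^ 3)
      ≤ (Set.Ioc 0 (κ / d)).indicator (fun _ => ENNReal.ofReal (64 * (κ / d) ^ 3)
          * volume (Metric.closedBall (0 : E3) s)) t
        + ∫⁻ x, ENNReal.ofReal (64 * K * m x)
          * {t : ℝ | t ^ 2 < K * m x}.indicator (fun t => ENNReal.ofReal t) t ∂ρ := by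
    intro t ht
    have ht0 : (0 : ℝ) < t := ht
    rcases le_or_gt t (κ / d) with htd | htd
    · rw [Set.indicator_of_mem (Set.mem_Ioc.2 ⟨ht0, htd⟩)]
      refine le_trans ?_ le_self_add
      rw [mul_comm]
      refine mul_le_mul' (ENNReal.ofReal_le_ofReal (by gcongr)) ?_
      calc μ {x | t < |g x| / 2} ≤ μ Set.univ := measure_mono (Set.subset_univ _)
        _ = _ := by rw [hμ, Measure.restrict_apply_univ]
    · refine le_trans ?_ le_add_self
      have h1 := h.levelSet_le hg hκ hm (s := s) hd htd
      rw [← hK] at h1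
      calc μ {x | t < |g x| / 2} * ENNReal.ofReal (64 * t ^ 3)
          = ENNReal.ofReal (64 * t) * (ENNReal.ofReal (t ^ 2) * μ {x | t < |g x| / 2}) := by
            rw [← mul_assoc, ← ENNReal.ofReal_mul (by positivity), mul_comm]
            congr 2
            ring
        _ ≤ _ := mul_le_mul_right h1 _
        _ = _ := by
            rw [← mul_assoc, ← ENNReal.ofReal_mul (by positivity),
              ← lintegral_const_mul' _ _ ENNReal.ofReal_ne_top]
            refine lintegral_congr fun x => ?_
            by_cases hx : t ^ 2 < K * m x
            · rw [Set.indicator_of_mem (by exact hx), Set.indicator_of_mem (by exact hx),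
                ← ENNReal.ofReal_mul (by positivity), ← ENNReal.ofReal_mul (by have := hm0 x; positivity)]
              congr 1
              ring
            · rw [Set.indicator_of_notMem (by exact hx), Set.indicator_of_notMem (by exact hx),
                mul_zero, mul_zero]
  have hmeas : Measurable fun z : ℝ × E3 => ENNReal.ofReal (64 * K * m z.2)
      * {t : ℝ | t ^ 2 < K * m z.2}.indicator (fun t => ENNReal.ofReal t) z.1 := by
    have h1 : Measurable fun z : ℝ × E3 => m z.2 := hmc.measurable.comp measurable_snd
    refine (h1.const_mul _).ennreal_ofReal.mul ?_
    exact Measurable.indicator (s := {z : ℝ × E3 | z.1 ^ 2 < K * m z.2})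
      measurable_fst.ennreal_ofReal
      (measurableSet_lt (measurable_fst.pow_const 2) (h1.const_mul _))
  refine (setLIntegral_mono' measurableSet_Ioi hint).trans ?_
  rw [lintegral_add_left (measurable_const.indicator measurableSet_Ioc)]
  refine add_le_add ?_ ?_
  · refine (setLIntegral_le_lintegral _ _).trans ?_
    rw [lintegral_indicator measurableSet_Ioc, setLIntegral_const, Real.volume_Ioc, sub_zero,
      mul_right_comm, ← ENNReal.ofReal_mul (by positivity)]
    refine mul_le_mul_left (ENNReal.ofReal_le_ofReal (le_of_eq ?_)) _
    ring
  · rw [lintegral_lintegral_swap hmeas.aemeasurable]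
    refine lintegral_mono fun x => ?_
    rw [lintegral_const_mul' _ _ ENNReal.ofReal_ne_top]
    refine (mul_le_mul_right (lintegral_Ioi_indicator_le (mul_nonneg hK0.le (hm0 x))) _).trans ?_
    have := hm0 x
    rw [← ENNReal.ofReal_mul (by positivity)]
    refine ENNReal.ofReal_le_ofReal (le_of_eq ?_)
    ring

/-- Local improvement `‖g‖_{L⁴}⁴ ≲ κ² ‖∇g‖_{L²}² + l.o.t.` for functions whose mollifications
at scale `ε` are bounded by `κ / ε`. -/
theorem IsMollifier.integral_pow_four_le {η : E3 → ℝ} {c₀ : ℝ} (h : IsMollifier η c₀)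
    {g : E3 → ℝ} (hg : ContDiff ℝ (⊤ : ℕ∞) g) {κ : ℝ} (hκ : 0 < κ)
    (hm : ∀ x ε, 0 < ε → |∫ y, η y * g (x - ε • y)| ≤ κ / ε) {s d : ℝ} (hd : 0 < d) :
    ∫ x in Metric.closedBall (0 : E3) s, g x ^ 4
      ≤ 768 * (c₀ * volume.real (Metric.closedBall (0 : E3) 1) * κ) ^ 2
          * (∫ x in Metric.closedBall (0 : E3) (s + d), ∑ i, pd g i x ^ 2)
        + 64 * (κ / d) ^ 4 * volume.real (Metric.closedBall (0 : E3) s) := by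
  have h1 := h.lintegral_pow_four_le hg hκ hm (s := s) hd rfl
  set K := 2 * c₀ * volume.real (Metric.closedBall (0 : E3) 1) * κ with hK
  have hc := fun i => continuous_pd hg i
  have hg' := hg.continuous
  rw [← ofReal_integral_eq_lintegral_ofReal
      (Continuous.integrableOn_closedBall_E3 (f := fun x => g x ^ 4) (by fun_prop) 0 s)
      (Filter.Eventually.of_forall fun x => by change (0 : ℝ) ≤ g x ^ 4; positivity),
    ← ofReal_integral_eq_lintegral_ofReal
      (Continuous.integrableOn_closedBall_E3 (by fun_prop) 0 (s + d))
      (Filter.Eventually.of_forall fun x => by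
        change (0 : ℝ) ≤ 64 * K ^ 2 * (∑ i, |pd g i x|) ^ 2
        positivity),
    ← ofReal_measureReal measure_closedBall_lt_top.ne, ← ENNReal.ofReal_mul (by positivity),
    ← ENNReal.ofReal_add (by positivity) (integral_nonneg fun x => by positivity),
    ENNReal.ofReal_le_ofReal_iff
      (add_nonneg (by positivity) (integral_nonneg fun x => by positivity))] at h1
  refine h1.trans ?_
  rw [add_comm]
  refine add_le_add ?_ le_rfl
  rw [← integral_const_mul]
  refine integral_mono (Continuous.integrableOn_closedBall_E3 (by fun_prop) 0 (s + d))
    (Continuous.integrableOn_closedBall_E3 (by fun_prop) 0 (s + d)) fun x => ?_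
  have h2 : (∑ i, |pd g i x|) ^ 2 ≤ 3 * ∑ i, pd g i x ^ 2 := by
    have := sq_sum_le_card_mul_sum_sq (s := (Finset.univ : Finset (Fin 3)))
      (f := fun i => |pd g i x|)
    simpa using this
  calc 64 * K ^ 2 * (∑ i, |pd g i x|) ^ 2 ≤ 64 * K ^ 2 * (3 * ∑ i, pd g i x ^ 2) := by gcongr
    _ = _ := by rw [hK]; ring


/-! ### The energy identity -/

theorem pd_const_mul {f : E3 → ℝ} (hf : Differentiable ℝ f) (c : ℝ) (i : Fin 3) (x : E3) :
    pd (fun y => c * f y) i x = c * pd f i x := by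
  unfold pd
  rw [fderiv_const_mul (hf x)]
  simp

theorem pd_sum {f : Fin 3 → E3 → ℝ} (hf : ∀ j, Differentiable ℝ (f j)) (i : Fin 3) (x : E3) :
    pd (fun y => ∑ j, f j y) i x = ∑ j, pd (f j) i x := by
  unfold pd
  rw [fderiv_fun_sum fun j _ => hf j x]
  simp

/-- Smooth solutions of the stationary MHD system, in components. -/
structure IsMHD (u w : Fin 3 → E3 → ℝ) (P : E3 → ℝ) : Prop where
  smooth_u : ∀ j, ContDiff ℝ (⊤ : ℕ∞) (u j)
  smooth_w : ∀ j, ContDiff ℝ (⊤ : ℕ∞) (w j)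
  smooth_P : ContDiff ℝ (⊤ : ℕ∞) P
  momentum : ∀ x j, -(lap (u j) x) + (∑ i, u i x * pd (u j) i x)
    = -(pd P j x) + ∑ i, w i x * pd (w j) i x
  induction : ∀ x j, -(lap (w j) x) + (∑ i, u i x * pd (w j) i x)
    - (∑ i, w i x * pd (u j) i x) = 0
  div_u : ∀ x, ∑ i, pd (u i) i x = 0
  div_w : ∀ x, ∑ i, pd (w i) i x = 0

/-- `|∇u|² + |∇w|²`. -/
noncomputable def gradSq (u w : Fin 3 → E3 → ℝ) (x : E3) : ℝ :=
  ∑ i, ∑ j, (pd (u j) i x ^ 2 + pd (w j) i x ^ 2)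

/-- `|u|² + |w|²`. -/
noncomputable def magSq (u w : Fin 3 → E3 → ℝ) (x : E3) : ℝ :=
  ∑ j, (u j x ^ 2 + w j x ^ 2)

/-- The flux in the local energy balance, apart from the pressure. -/
noncomputable def energyFlux (u w : Fin 3 → E3 → ℝ) (i : Fin 3) (x : E3) : ℝ :=
  (∑ j, (u j x * pd (u j) i x + w j x * pd (w j) i x))
    - 2⁻¹ * ((∑ j, (u j x * u j x + w j x * w j x)) * u i x)
    + (∑ j, u j x * w j x) * w i x

theorem smooth_energyFlux {u w : Fin 3 → E3 → ℝ} (hu : ∀ j, ContDiff ℝ (⊤ : ℕ∞) (u j))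
    (hw : ∀ j, ContDiff ℝ (⊤ : ℕ∞) (w j)) (i : Fin 3) :
    ContDiff ℝ (⊤ : ℕ∞) (energyFlux u w i) := by
  have h1 := fun j => smooth_pd (hu j) i
  have h2 := fun j => smooth_pd (hw j) i
  unfold energyFlux
  fun_prop

theorem IsMHD.div_energyFlux {u w : Fin 3 → E3 → ℝ} {P : E3 → ℝ} (h : IsMHD u w P) (x : E3) :
    ∑ i, pd (energyFlux u w i) i x = gradSq u w x + ∑ j, u j x * pd P j x := by
  have hu := fun j => differentiable_of_smooth (h.smooth_u j)
  have hw := fun j => differentiable_of_smooth (h.smooth_w j)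
  have hdu := fun j i => differentiable_of_smooth (smooth_pd (h.smooth_u j) i)
  have hdw := fun j i => differentiable_of_smooth (smooth_pd (h.smooth_w j) i)
  have hpd : ∀ i, pd (energyFlux u w i) i x =
      (∑ j, (pd (u j) i x ^ 2 + u j x * pd (pd (u j) i) i x
        + (pd (w j) i x ^ 2 + w j x * pd (pd (w j) i) i x)))
      - ((∑ j, (u j x * pd (u j) i x + w j x * pd (w j) i x)) * u i x
        + 2⁻¹ * ((∑ j, (u j x * u j x + w j x * w j x)) * pd (u i) i x))
      + ((∑ j, (pd (u j) i x * w j x + u j x * pd (w j) i x)) * w i x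
        + (∑ j, u j x * w j x) * pd (w i) i x) := by
    intro i
    unfold energyFlux
    rw [pd_add (by fun_prop) (by fun_prop), pd_sub (by fun_prop) (by fun_prop),
      pd_const_mul (by fun_prop), pd_mul (by fun_prop) (by fun_prop),
      pd_mul (by fun_prop) (by fun_prop), pd_sum (by fun_prop), pd_sum (by fun_prop),
      pd_sum (by fun_prop)]
    have h1 : ∀ j, pd (fun y => u j y * pd (u j) i y + w j y * pd (w j) i y) i x
        = pd (u j) i x ^ 2 + u j x * pd (pd (u j) i) i x
          + (pd (w j) i x ^ 2 + w j x * pd (pd (w j) i) i x) := by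
      intro j
      rw [pd_add (by fun_prop) (by fun_prop), pd_mul (by fun_prop) (by fun_prop),
        pd_mul (by fun_prop) (by fun_prop)]
      ring
    have h2 : ∀ j, pd (fun y => u j y * u j y + w j y * w j y) i x
        = 2 * (u j x * pd (u j) i x + w j x * pd (w j) i x) := by
      intro j
      rw [pd_add (by fun_prop) (by fun_prop), pd_mul (by fun_prop) (by fun_prop),
        pd_mul (by fun_prop) (by fun_prop)]
      ring
    have h3 : ∀ j, pd (fun y => u j y * w j y) i x = pd (u j) i x * w j x + u j x * pd (w j) i x :=
      fun j => pd_mul (hu j) (hw j) i x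
    simp only [h1, h2, h3, ← Finset.mul_sum]
    ring
  simp only [hpd, gradSq]
  have e1 := h.momentum x
  have e2 := h.induction x
  have e3 := h.div_u x
  have e4 := h.div_w x
  simp only [lap] at e1 e2
  have a0 := e1 0
  have a1 := e1 1
  have a2 := e1 2
  have b0 := e2 0
  have b1 := e2 1
  have b2 := e2 2
  simp only [Fin.sum_univ_three] at a0 a1 a2 b0 b1 b2 e3 e4 ⊢
  linear_combination (-(u 0 x)) * a0 - u 1 x * a1 - u 2 x * a2 - w 0 x * b0 - w 1 x * b1
    - w 2 x * b2
    - 2⁻¹ * (u 0 x * u 0 x + w 0 x * w 0 x + (u 1 x * u 1 x + w 1 x * w 1 x)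
      + (u 2 x * u 2 x + w 2 x * w 2 x)) * e3
    + (u 0 x * w 0 x + u 1 x * w 1 x + u 2 x * w 2 x) * e4

theorem continuous_gradSq {u w : Fin 3 → E3 → ℝ} (hu : ∀ j, ContDiff ℝ (⊤ : ℕ∞) (u j))
    (hw : ∀ j, ContDiff ℝ (⊤ : ℕ∞) (w j)) : Continuous (gradSq u w) := by
  have h1 := fun j i => continuous_pd (hu j) i
  have h2 := fun j i => continuous_pd (hw j) i
  unfold gradSq
  fun_prop

theorem continuous_magSq {u w : Fin 3 → E3 → ℝ} (hu : ∀ j, ContDiff ℝ (⊤ : ℕ∞) (u j))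
    (hw : ∀ j, ContDiff ℝ (⊤ : ℕ∞) (w j)) : Continuous (magSq u w) := by
  have h1 := fun j => (hu j).continuous
  have h2 := fun j => (hw j).continuous
  unfold magSq
  fun_prop

theorem IsMHD.integral_energy {u w : Fin 3 → E3 → ℝ} {P : E3 → ℝ} (h : IsMHD u w P)
    {φ : E3 → ℝ} (hφ : ContDiff ℝ (⊤ : ℕ∞) φ) (hc : HasCompactSupport φ) :
    ∫ x, φ x * gradSq u w x
      = -(∫ x, ∑ i, pd φ i x * energyFlux u w i x) - ∫ x, φ x * ∑ j, u j x * pd P j x := by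
  have hT := smooth_energyFlux h.smooth_u h.smooth_w
  have hTc := fun i => (hT i).continuous
  have hcp : ∀ i, HasCompactSupport (pd φ i) := fun i => hc.fderiv_apply ℝ _
  have hi1 : Integrable fun x => ∑ i, pd φ i x * energyFlux u w i x :=
    integrable_finsetSum _ fun i _ =>
      ((continuous_pd hφ i).mul (hTc i)).integrable_of_hasCompactSupport (hcp i).mul_right
  have hi2 : Integrable fun x => φ x * gradSq u w x :=
    (hφ.continuous.mul (continuous_gradSq h.smooth_u h.smooth_w)).integrable_of_hasCompactSupport
      hc.mul_right
  have hi3 : Integrable fun x => φ x * ∑ j, u j x * pd P j x := by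
    refine Continuous.integrable_of_hasCompactSupport ?_ hc.mul_right
    have h1 := fun j => (h.smooth_u j).continuous
    have h2 := fun j => continuous_pd h.smooth_P j
    have h3 := hφ.continuous
    fun_prop
  have hzero : ∫ x, ∑ i, pd (fun y => φ y * energyFlux u w i y) i x = 0 := by
    rw [integral_finsetSum]
    · exact Finset.sum_eq_zero fun i _ => integral_pd_eq_zero (hφ.mul (hT i)) hc.mul_right i
    · intro i _
      refine (continuous_pd (hφ.mul (hT i)) i).integrable_of_hasCompactSupport ?_
      exact (hc.mul_right (f' := energyFlux u w i)).fderiv_apply ℝ _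
  have hpt : ∀ x, ∑ i, pd (fun y => φ y * energyFlux u w i y) i x
      = (∑ i, pd φ i x * energyFlux u w i x) + φ x * gradSq u w x
        + φ x * ∑ j, u j x * pd P j x := by
    intro x
    simp only [pd_mul (differentiable_of_smooth hφ) (differentiable_of_smooth (hT _)),
      Finset.sum_add_distrib, ← Finset.mul_sum, h.div_energyFlux]
    ring
  simp only [hpt] at hzero
  have hi12 : Integrable fun x => (∑ i, pd φ i x * energyFlux u w i x) + φ x * gradSq u w x :=
    hi1.add hi2
  rw [integral_add hi12 hi3, integral_add hi1 hi2] at hzero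
  linarith


/-! ### The pressure -/

theorem pd_comm {f : E3 → ℝ} (hf : ContDiff ℝ (⊤ : ℕ∞) f) (i j : Fin 3) :
    pd (pd f i) j = pd (pd f j) i := by
  have hd : Differentiable ℝ (fderiv ℝ f) :=
    (hf.fderiv_right (m := (⊤ : ℕ∞)) (by simp)).differentiable (by simp)
  have h1 : ∀ i j x, pd (pd f i) j x
      = fderiv ℝ (fderiv ℝ f) x (EuclideanSpace.single j 1) (EuclideanSpace.single i 1) := by
    intro i j x
    have h2 : pd f i = fun y => fderiv ℝ f y (EuclideanSpace.single i 1) := rfl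
    rw [h2, pd, fderiv_clm_apply (hd x) (differentiableAt_const _)]
    simp
  funext x
  rw [h1, h1]
  exact (hf.contDiffAt.isSymmSndFDerivAt
    (by rw [minSmoothness_of_isRCLikeNormedField]; exact WithTop.coe_le_coe.2 le_top)).eq _ _

theorem pd_translate (f : E3 → ℝ) (c : E3) (i : Fin 3) (x : E3) :
    pd (fun z => f (z - c)) i x = pd f i (x - c) := by
  unfold pd
  simp only [sub_eq_add_neg]
  rw [fderiv_comp_add_right]

theorem smooth_lap {f : E3 → ℝ} (hf : ContDiff ℝ (⊤ : ℕ∞) f) : ContDiff ℝ (⊤ : ℕ∞) (lap f) := by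
  have := fun i => smooth_pd (smooth_pd hf i) i
  exact ContDiff.sum fun i _ => this i

theorem div_lap_eq_zero {u : Fin 3 → E3 → ℝ} (hu : ∀ j, ContDiff ℝ (⊤ : ℕ∞) (u j))
    (hdiv : ∀ x, ∑ j, pd (u j) j x = 0) (x : E3) : ∑ j, pd (lap (u j)) j x = 0 := by
  have hs := fun j i => smooth_pd (hu j) i
  have hss := fun j i k => smooth_pd (hs j i) k
  have h1 : ∀ j, pd (lap (u j)) j x = ∑ i, pd (pd (pd (u j) j) i) i x := by
    intro j
    have h2 : lap (u j) = fun y => ∑ i, pd (pd (u j) i) i y := rfl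
    rw [h2, pd_sum fun i => differentiable_of_smooth (hss j i i)]
    refine Finset.sum_congr rfl fun i _ => ?_
    rw [pd_comm (hs j i) i j, pd_comm (hu j) i j]
  have h3 : (fun y => ∑ j, pd (u j) j y) = fun _ => 0 := funext hdiv
  have h4 : ∀ i, ∑ j, pd (pd (pd (u j) j) i) i x = 0 := by
    intro i
    have h5 : (fun y => ∑ j, pd (pd (u j) j) i y) = fun _ => 0 := by
      funext y
      rw [← pd_sum fun j => differentiable_of_smooth (hs j j), h3]
      simp [pd]
    rw [← pd_sum fun j => differentiable_of_smooth (hss j j i), h5]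
    simp [pd]
  simp only [h1]
  rw [Finset.sum_comm]
  exact Finset.sum_eq_zero fun i _ => h4 i

theorem integral_swap_of_eq_zero {K : E3 → E3 → ℝ} (hK : Continuous K.uncurry) {a b : ℝ}
    (ha : ∀ x y, a ≤ ‖x‖ → K x y = 0) (hb : ∀ x y, b ≤ ‖y‖ → K x y = 0) :
    ∫ x, ∫ y, K x y = ∫ y, ∫ x, K x y := by
  refine integral_integral_swap_of_hasCompactSupport hK ?_
  refine HasCompactSupport.intro
    ((isCompact_closedBall (0 : E3) a).prod (isCompact_closedBall (0 : E3) b)) fun z hz => ?_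
  rw [Set.mem_prod, not_and_or] at hz
  rcases hz with hz | hz
  · rw [mem_closedBall_zero_iff, not_le] at hz
    exact ha _ _ hz.le
  · rw [mem_closedBall_zero_iff, not_le] at hz
    exact hb _ _ hz.le

theorem integral_mul_transport {u : Fin 3 → E3 → ℝ} (hu : ∀ j, ContDiff ℝ (⊤ : ℕ∞) (u j))
    (hdiv : ∀ x, ∑ j, pd (u j) j x = 0) {φ : E3 → ℝ} (hφ : ContDiff ℝ (⊤ : ℕ∞) φ)
    (hc : HasCompactSupport φ) {Q : E3 → ℝ} (hQ : ContDiff ℝ (⊤ : ℕ∞) Q) :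
    ∫ x, φ x * ∑ j, u j x * pd Q j x = -∫ x, (∑ j, pd φ j x * u j x) * Q x := by
  have hs := fun j => hφ.mul (hu j)
  have hcs := fun j => hc.mul_right (f' := u j)
  have hd := fun j => differentiable_of_smooth (hu j)
  have h1 : ∀ x, φ x * ∑ j, u j x * pd Q j x = ∑ j, (φ x * u j x) * pd Q j x := by
    intro x
    rw [Finset.mul_sum]
    exact Finset.sum_congr rfl fun j _ => by ring
  have h2 : ∀ x, (∑ j, pd φ j x * u j x) * Q x = ∑ j, pd (fun y => φ y * u j y) j x * Q x := by
    intro x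
    rw [← Finset.sum_mul]
    congr 1
    simp only [pd_mul (differentiable_of_smooth hφ) (hd _), Finset.sum_add_distrib,
      ← Finset.mul_sum, hdiv]
    ring
  simp only [h1, h2]
  rw [integral_finsetSum, integral_finsetSum, ← Finset.sum_neg_distrib]
  · exact Finset.sum_congr rfl fun j _ => integral_mul_pd_eq_neg (hs j) hQ (hcs j) j
  · intro j _
    exact ((continuous_pd (hs j) j).mul hQ.continuous).integrable_of_hasCompactSupport
      (((hcs j).fderiv_apply ℝ _).mul_right)
  · intro j _
    exact ((hs j).continuous.mul (continuous_pd hQ j)).integrable_of_hasCompactSupport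
      (hcs j).mul_right

theorem IsMollifier.integral_transport_eq {η : E3 → ℝ} {c₀ : ℝ} (h : IsMollifier η c₀)
    {u : Fin 3 → E3 → ℝ} (hu : ∀ j, ContDiff ℝ (⊤ : ℕ∞) (u j))
    (hdiv : ∀ x, ∑ j, pd (u j) j x = 0) {φ : E3 → ℝ} (hφ : ContDiff ℝ (⊤ : ℕ∞) φ) {a : ℝ}
    (ha : ∀ x, a ≤ ‖x‖ → φ x = 0) (ha' : ∀ j x, a ≤ ‖x‖ → pd φ j x = 0)
    {Q : E3 → ℝ} (hQ : ContDiff ℝ (⊤ : ℕ∞) Q) (δ : ℝ) :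
    ∫ x, φ x * ∑ j, u j x * pd Q j x
      = (∫ x, ∫ y, η y * (φ x * ∑ j, u j x * pd Q j (x - δ • y)))
        - ∫ x, (∑ j, pd φ j x * u j x) * (Q x - ∫ y, η y * Q (x - δ • y)) := by
  have hc := hasCompactSupport_of_eq_zero ha
  have hη := h.smooth.continuous
  have huc := fun j => (hu j).continuous
  have hQc := hQ.continuous
  have hQd := fun j => continuous_pd hQ j
  have hφc := hφ.continuous
  have hφd := fun j => continuous_pd hφ j
  set ψ : E3 → ℝ := fun x => ∑ j, pd φ j x * u j x with hψ
  have hψc : Continuous ψ := by fun_prop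
  have hψ0 : ∀ x, a ≤ ‖x‖ → ψ x = 0 := fun x hx =>
    Finset.sum_eq_zero fun j _ => by rw [ha' j x hx, zero_mul]
  have hψs : HasCompactSupport ψ := hasCompactSupport_of_eq_zero hψ0
  have hswap1 : ∫ x, ∫ y, η y * (φ x * ∑ j, u j x * pd Q j (x - δ • y))
      = ∫ y, ∫ x, η y * (φ x * ∑ j, u j x * pd Q j (x - δ • y)) := by
    refine integral_swap_of_eq_zero (a := a) (b := 1) ?_ ?_ ?_
    · unfold Function.uncurry
      fun_prop
    · intro x y hx
      rw [ha x hx, zero_mul, mul_zero]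
    · intro x y hy
      rw [h.eq_zero y hy, zero_mul]
  have hswap2 : ∫ x, ∫ y, ψ x * (η y * Q (x - δ • y))
      = ∫ y, ∫ x, ψ x * (η y * Q (x - δ • y)) := by
    refine integral_swap_of_eq_zero (a := a) (b := 1) ?_ ?_ ?_
    · unfold Function.uncurry
      fun_prop
    · intro x y hx
      rw [hψ0 x hx, zero_mul]
    · intro x y hy
      rw [h.eq_zero y hy, zero_mul, mul_zero]
  have hy : ∀ y, ∫ x, η y * (φ x * ∑ j, u j x * pd Q j (x - δ • y))
      = -∫ x, ψ x * (η y * Q (x - δ • y)) := by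
    intro y
    have h1 := integral_mul_transport hu hdiv hφ hc (Q := fun z => Q (z - δ • y))
      (hQ.comp (contDiff_id.sub contDiff_const))
    simp only [pd_translate] at h1
    rw [integral_const_mul, h1, mul_neg, ← integral_const_mul]
    congr 1
    refine integral_congr_ae (Filter.Eventually.of_forall fun x => ?_)
    change η y * (ψ x * Q (x - δ • y)) = ψ x * (η y * Q (x - δ • y))
    ring
  have hcA : Continuous fun x => ∫ y, η y * Q (x - δ • y) := by
    have h1 : (fun x => ∫ y, η y * Q (x - δ • y))
        = fun x => ∫ y in Metric.closedBall (0 : E3) 1, η y * Q (x - δ • y) :=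
      funext fun x => (h.setIntegral_eq _).symm
    rw [h1]
    refine continuous_parametric_integral_of_continuous ?_ (isCompact_closedBall _ _)
    unfold Function.uncurry
    fun_prop
  rw [hswap1]
  simp only [hy, mul_sub]
  rw [integral_neg, ← hswap2, integral_sub]
  · simp only [integral_const_mul]
    rw [integral_mul_transport hu hdiv hφ hc hQ]
    change -∫ x, ψ x * Q x = _
    ring
  · exact (hψc.mul hQc).integrable_of_hasCompactSupport hψs.mul_right
  · exact (hψc.mul hcA).integrable_of_hasCompactSupport hψs.mul_right

/-- The tensor whose divergence is the pressure gradient. -/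
noncomputable def stressTensor (u w : Fin 3 → E3 → ℝ) (i j : Fin 3) (x : E3) : ℝ :=
  pd (u j) i x - (u i x * u j x - w i x * w j x)

theorem smooth_stressTensor {u w : Fin 3 → E3 → ℝ} (hu : ∀ j, ContDiff ℝ (⊤ : ℕ∞) (u j))
    (hw : ∀ j, ContDiff ℝ (⊤ : ℕ∞) (w j)) (i j : Fin 3) :
    ContDiff ℝ (⊤ : ℕ∞) (stressTensor u w i j) := by
  have h1 := smooth_pd (hu j) i
  unfold stressTensor
  fun_prop

theorem IsMHD.pd_pressure_eq {u w : Fin 3 → E3 → ℝ} {P : E3 → ℝ} (h : IsMHD u w P) (j : Fin 3)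
    (x : E3) : pd P j x = ∑ i, pd (stressTensor u w i j) i x := by
  have hu := fun j => differentiable_of_smooth (h.smooth_u j)
  have hw := fun j => differentiable_of_smooth (h.smooth_w j)
  have hdu := fun j i => differentiable_of_smooth (smooth_pd (h.smooth_u j) i)
  have h1 : ∀ i, pd (stressTensor u w i j) i x = pd (pd (u j) i) i x
      - (pd (u i) i x * u j x + u i x * pd (u j) i x
        - (pd (w i) i x * w j x + w i x * pd (w j) i x)) := by
    intro i
    unfold stressTensor
    rw [pd_sub (by fun_prop) (by fun_prop), pd_sub (by fun_prop) (by fun_prop),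
      pd_mul (by fun_prop) (by fun_prop), pd_mul (by fun_prop) (by fun_prop)]
  simp only [h1, Finset.sum_sub_distrib, Finset.sum_add_distrib, ← Finset.sum_mul, h.div_u, h.div_w]
  have h2 := h.momentum x j
  simp only [lap] at h2
  linarith

theorem IsMHD.pd_pressure_eq_lap {u w : Fin 3 → E3 → ℝ} {P : E3 → ℝ} (h : IsMHD u w P) (j : Fin 3)
    (x : E3) : pd P j x
      = lap (u j) x - ∑ i, (u i x * pd (u j) i x - w i x * pd (w j) i x) := by
  have h2 := h.momentum x j
  rw [Finset.sum_sub_distrib]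
  linarith

theorem IsMHD.mollified_pressure_eq {u w : Fin 3 → E3 → ℝ} {P : E3 → ℝ} (h : IsMHD u w P)
    {η : E3 → ℝ} {c₀ : ℝ} (hη : IsMollifier η c₀) {δ : ℝ} (hδ : δ ≠ 0) (c : Fin 3 → ℝ) (x : E3) :
    ∫ y, η y * ∑ j, c j * pd P j (x - δ • y)
      = ∫ y in Metric.closedBall (0 : E3) 1,
          δ⁻¹ * ∑ i, ∑ j, pd η i y * (c j * stressTensor u w i j (x - δ • y)) := by
  have hN := fun i j => smooth_stressTensor h.smooth_u h.smooth_w i j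
  have hNc := fun i j => (hN i j).continuous
  have hNd := fun i j => continuous_pd (hN i j) i
  have hηc := hη.smooth.continuous
  have hηd := fun i => continuous_pd hη.smooth i
  have hs : ∀ i, ContDiff ℝ (⊤ : ℕ∞) fun z => ∑ j, c j * stressTensor u w i j z := fun i =>
    ContDiff.sum fun j _ => contDiff_const.mul (hN i j)
  have hpt : ∀ z, ∑ j, c j * pd P j z = ∑ i, pd (fun z => ∑ j, c j * stressTensor u w i j z) i z := by
    intro z
    have h1 : ∀ i, pd (fun z => ∑ j, c j * stressTensor u w i j z) i z
        = ∑ j, c j * pd (stressTensor u w i j) i z := by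
      intro i
      rw [pd_sum fun j => (differentiable_of_smooth (hN i j)).const_mul _]
      exact Finset.sum_congr rfl fun j _ => pd_const_mul (differentiable_of_smooth (hN i j)) _ _ _
    simp only [h1, h.pd_pressure_eq, Finset.mul_sum]
    exact Finset.sum_comm
  rw [setIntegral_eq_integral_of_forall_compl_eq_zero (fun y hy => by
    rw [mem_closedBall_zero_iff, not_le] at hy
    simp [hη.pd_eq_zero _ y hy.le])]
  have hleft : ∀ y, η y * ∑ j, c j * pd P j (x - δ • y)
      = ∑ i, η y * pd (fun z => ∑ j, c j * stressTensor u w i j z) i (x - δ • y) := fun y => by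
    rw [hpt, Finset.mul_sum]
  have hright : ∀ y, ∑ i, ∑ j, pd η i y * (c j * stressTensor u w i j (x - δ • y))
      = ∑ i, pd η i y * ∑ j, c j * stressTensor u w i j (x - δ • y) := fun y =>
    Finset.sum_congr rfl fun i _ => (Finset.mul_sum _ _ _).symm
  simp only [hleft, hright]
  rw [integral_const_mul, integral_finsetSum, integral_finsetSum, Finset.mul_sum]
  · exact Finset.sum_congr rfl fun i _ =>
      integral_mul_pd_shift hη.smooth (hs i) hη.hasCompactSupport hδ i x
  · intro i _
    refine Continuous.integrable_of_hasCompactSupport ?_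
      ((hη.hasCompactSupport.fderiv_apply ℝ _).mul_right)
    have := hηd i
    have h2 := (hs i).continuous
    fun_prop
  · intro i _
    refine Continuous.integrable_of_hasCompactSupport ?_ hη.hasCompactSupport.mul_right
    have h2 := continuous_pd (hs i) i
    fun_prop

theorem IsMHD.pressure_sub_mollified_eq {u w : Fin 3 → E3 → ℝ} {P : E3 → ℝ} (h : IsMHD u w P)
    {η : E3 → ℝ} {c₀ : ℝ} (hη : IsMollifier η c₀) (δ : ℝ) (x : E3) :
    P x - ∫ y, η y * P (x - δ • y)
      = -∫ q, η q.2 * (δ * ∑ j, q.2 j *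
          ∑ i, (u i (x - (q.1 * δ) • q.2) * pd (u j) i (x - (q.1 * δ) • q.2)
            - w i (x - (q.1 * δ) • q.2) * pd (w j) i (x - (q.1 * δ) • q.2))) ∂segMeasure := by
  have hηc := hη.smooth.continuous
  have h1 := fun j => (h.smooth_u j).continuous
  have h2 := fun j => (h.smooth_w j).continuous
  have h3 := fun j i => continuous_pd (h.smooth_u j) i
  have h4 := fun j i => continuous_pd (h.smooth_w j) i
  have h5 := fun j => (smooth_lap (h.smooth_u j)).continuous
  have hlap : Continuous fun q : ℝ × E3 =>
      η q.2 * (δ * ∑ j, q.2 j * lap (u j) (x - (q.1 * δ) • q.2)) := by fun_prop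
  have hzero : ∫ q, η q.2 * (δ * ∑ j, q.2 j * lap (u j) (x - (q.1 * δ) • q.2)) ∂segMeasure = 0 := by
    have hi := hlap.integrable_segMeasure
    unfold segMeasure at hi ⊢
    rw [integral_prod _ hi]
    refine integral_eq_zero_of_ae (Filter.Eventually.of_forall fun σ => ?_)
    change ∫ y in Metric.closedBall (0 : E3) 1,
      η y * (δ * ∑ j, y j * lap (u j) (x - (σ * δ) • y)) = 0
    rw [hη.setIntegral_eq fun y => δ * ∑ j, y j * lap (u j) (x - (σ * δ) • y)]
    simp only [mul_left_comm _ δ]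
    rw [integral_const_mul, hη.moment (fun j => lap (u j)) (fun j => smooth_lap (h.smooth_u j))
      (div_lap_eq_zero h.smooth_u h.div_u), mul_zero]
  rw [hη.sub_mollified_eq h.smooth_P, ← sub_zero (integral _ _), ← hzero, ← integral_neg]
  rw [← integral_sub]
  · refine integral_congr_ae (Filter.Eventually.of_forall fun q => ?_)
    simp only [h.pd_pressure_eq_lap, mul_sub, Finset.sum_sub_distrib]
    ring
  · have h6 := fun j => continuous_pd h.smooth_P j
    exact Continuous.integrable_segMeasure (by fun_prop)
  · exact hlap.integrable_segMeasure


/-! ### Pointwise bounds -/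

/-- A linear quantity controlling all fluxes: `|∇u| + |∇w| + 3 (|u|² + |w|²)`. -/
noncomputable def fluxBound (u w : Fin 3 → E3 → ℝ) (x : E3) : ℝ :=
  (∑ i, ∑ j, (|pd (u j) i x| + |pd (w j) i x|)) + 3 * magSq u w x

/-- The density `|∇u|² + |∇w|² + (|u|² + |w|²)²`. -/
noncomputable def density (u w : Fin 3 → E3 → ℝ) (x : E3) : ℝ :=
  gradSq u w x + magSq u w x ^ 2

section

variable (u w : Fin 3 → E3 → ℝ)

theorem magSq_nonneg (x : E3) : 0 ≤ magSq u w x :=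
  Finset.sum_nonneg fun j _ => by positivity

theorem gradSq_nonneg (x : E3) : 0 ≤ gradSq u w x :=
  Finset.sum_nonneg fun i _ => Finset.sum_nonneg fun j _ => by positivity

theorem density_nonneg (x : E3) : 0 ≤ density u w x :=
  add_nonneg (gradSq_nonneg u w x) (sq_nonneg _)

theorem abs_fst_le_sqrt_magSq (j : Fin 3) (x : E3) : |u j x| ≤ √(magSq u w x) := by
  refine Real.abs_le_sqrt ?_
  calc u j x ^ 2 ≤ u j x ^ 2 + w j x ^ 2 := by nlinarith [sq_nonneg (w j x)]
    _ ≤ _ := Finset.single_le_sum (f := fun j => u j x ^ 2 + w j x ^ 2)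
        (fun j _ => by positivity) (Finset.mem_univ j)

theorem abs_snd_le_sqrt_magSq (j : Fin 3) (x : E3) : |w j x| ≤ √(magSq u w x) := by
  refine Real.abs_le_sqrt ?_
  calc w j x ^ 2 ≤ u j x ^ 2 + w j x ^ 2 := by nlinarith [sq_nonneg (u j x)]
    _ ≤ _ := Finset.single_le_sum (f := fun j => u j x ^ 2 + w j x ^ 2)
        (fun j _ => by positivity) (Finset.mem_univ j)

theorem fluxBound_sq_le (x : E3) : fluxBound u w x ^ 2 ≤ 36 * density u w x := by
  have h1 : (∑ i, ∑ j, (|pd (u j) i x| + |pd (w j) i x|)) ^ 2 ≤ 18 * gradSq u w x := by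
    calc (∑ i, ∑ j, (|pd (u j) i x| + |pd (w j) i x|)) ^ 2
        ≤ 3 * ∑ i, (∑ j, (|pd (u j) i x| + |pd (w j) i x|)) ^ 2 := by
          simpa using sq_sum_le_card_mul_sum_sq (s := (Finset.univ : Finset (Fin 3)))
            (f := fun i => ∑ j, (|pd (u j) i x| + |pd (w j) i x|))
      _ ≤ 3 * ∑ i, 3 * ∑ j, (|pd (u j) i x| + |pd (w j) i x|) ^ 2 := by
          gcongr with i
          simpa using sq_sum_le_card_mul_sum_sq (s := (Finset.univ : Finset (Fin 3)))
            (f := fun j => (|pd (u j) i x| + |pd (w j) i x|))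
      _ ≤ 3 * ∑ i, 3 * ∑ j, 2 * (pd (u j) i x ^ 2 + pd (w j) i x ^ 2) := by
          gcongr with i _ j
          rw [← sq_abs (pd (u j) i x), ← sq_abs (pd (w j) i x)]
          exact add_sq_le
      _ = 18 * gradSq u w x := by
          simp only [gradSq, Finset.mul_sum]
          refine Finset.sum_congr rfl fun i _ => Finset.sum_congr rfl fun j _ => ?_
          ring
  unfold fluxBound density
  nlinarith [add_sq_le (a := ∑ i, ∑ j, (|pd (u j) i x| + |pd (w j) i x|))
    (b := 3 * magSq u w x)]

theorem abs_sum_mul_add_le (a b : Fin 3 → ℝ) (x : E3) :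
    |∑ j, (u j x * a j + w j x * b j)| ≤ √(magSq u w x) * ∑ j, (|a j| + |b j|) := by
  rw [Finset.mul_sum]
  refine (Finset.abs_sum_le_sum_abs _ _).trans (Finset.sum_le_sum fun j _ => ?_)
  rw [mul_add]
  refine (abs_add_le _ _).trans ?_
  rw [abs_mul, abs_mul]
  exact add_le_add
    (mul_le_mul_of_nonneg_right (abs_fst_le_sqrt_magSq u w j x) (abs_nonneg _))
    (mul_le_mul_of_nonneg_right (abs_snd_le_sqrt_magSq u w j x) (abs_nonneg _))

theorem sum_abs_energyFlux_le (x : E3) :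
    ∑ i, |energyFlux u w i x| ≤ √(magSq u w x) * fluxBound u w x := by
  have hU := magSq_nonneg u w x
  have h1 : ∀ i, |energyFlux u w i x| ≤ √(magSq u w x) *
      ((∑ j, (|pd (u j) i x| + |pd (w j) i x|)) + magSq u w x) := by
    intro i
    have e1 : ∑ j, (u j x * u j x + w j x * w j x) = magSq u w x :=
      Finset.sum_congr rfl fun j _ => by ring
    have e2 : |∑ j, u j x * w j x| ≤ 2⁻¹ * magSq u w x := by
      rw [magSq, Finset.mul_sum]
      refine (Finset.abs_sum_le_sum_abs _ _).trans (Finset.sum_le_sum fun j _ => ?_)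
      rw [abs_le]
      constructor <;> nlinarith [sq_nonneg (u j x + w j x), sq_nonneg (u j x - w j x)]
    unfold energyFlux
    rw [e1]
    have e3 := abs_sum_mul_add_le u w (fun j => pd (u j) i x) (fun j => pd (w j) i x) x
    have e4 : |2⁻¹ * (magSq u w x * u i x)| ≤ 2⁻¹ * (magSq u w x * √(magSq u w x)) := by
      rw [abs_mul, abs_mul, abs_of_nonneg hU, abs_of_pos (by norm_num : (0 : ℝ) < 2⁻¹)]
      gcongr
      exact abs_fst_le_sqrt_magSq u w i x
    have e5 : |(∑ j, u j x * w j x) * w i x| ≤ 2⁻¹ * magSq u w x * √(magSq u w x) := by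
      rw [abs_mul]
      gcongr
      exact abs_snd_le_sqrt_magSq u w i x
    refine (abs_add_le _ _).trans ((add_le_add_left (abs_sub _ _) _).trans ?_)
    linarith
  refine (Finset.sum_le_sum fun i _ => h1 i).trans (le_of_eq ?_)
  rw [← Finset.mul_sum, Finset.sum_add_distrib, fluxBound]
  simp

theorem sum_abs_stressTensor_le (x : E3) :
    ∑ i, ∑ j, |stressTensor u w i j x| ≤ fluxBound u w x := by
  have h1 : ∀ i j, |stressTensor u w i j x| ≤ (|pd (u j) i x| + |pd (w j) i x|)
      + (2⁻¹ * (u i x ^ 2 + w i x ^ 2) + 2⁻¹ * (u j x ^ 2 + w j x ^ 2)) := by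
    intro i j
    unfold stressTensor
    refine (abs_sub _ _).trans (add_le_add (le_add_of_nonneg_right (abs_nonneg _)) ?_)
    rw [abs_le]
    constructor <;> nlinarith [sq_nonneg (u i x + u j x), sq_nonneg (u i x - u j x),
      sq_nonneg (w i x + w j x), sq_nonneg (w i x - w j x)]
  refine (Finset.sum_le_sum fun i _ => Finset.sum_le_sum fun j _ => h1 i j).trans (le_of_eq ?_)
  simp only [fluxBound, magSq, Fin.sum_univ_three]
  ring

theorem sum_abs_transport_le (x : E3) :
    ∑ j, |∑ i, (u i x * pd (u j) i x - w i x * pd (w j) i x)|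
      ≤ √(magSq u w x) * fluxBound u w x := by
  have h1 : ∀ j, |∑ i, (u i x * pd (u j) i x - w i x * pd (w j) i x)|
      ≤ √(magSq u w x) * ∑ i, (|pd (u j) i x| + |pd (w j) i x|) := by
    intro j
    simpa [sub_eq_add_neg] using
      abs_sum_mul_add_le u w (fun i => pd (u j) i x) (fun i => -pd (w j) i x) x
  refine (Finset.sum_le_sum fun j _ => h1 j).trans ?_
  rw [← Finset.mul_sum, Finset.sum_comm, fluxBound]
  have := magSq_nonneg u w x
  gcongr
  linarith

end

theorem continuous_density {u w : Fin 3 → E3 → ℝ} (hu : ∀ j, ContDiff ℝ (⊤ : ℕ∞) (u j))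
    (hw : ∀ j, ContDiff ℝ (⊤ : ℕ∞) (w j)) : Continuous (density u w) :=
  (continuous_gradSq hu hw).add ((continuous_magSq hu hw).pow 2)

theorem exists_young {A θ : ℝ} (hθ : 0 < θ) :
    ∃ C : ℝ, 0 ≤ C ∧ ∀ d r z : ℝ, 0 < d → A / d * (r * z) ≤ θ * (z ^ 2 + r ^ 4) + C / d ^ 4 := by
  refine ⟨A ^ 4 / (64 * θ ^ 3), by positivity, fun d r z hd => ?_⟩
  have h1 : A / d * (r * z) ≤ θ * z ^ 2 + (A / d) ^ 2 * r ^ 2 / (4 * θ) := by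
    have : 0 ≤ (2 * θ * z - A / d * r) ^ 2 / (4 * θ) := by positivity
    have e : (2 * θ * z - A / d * r) ^ 2 / (4 * θ)
        = θ * z ^ 2 + (A / d) ^ 2 * r ^ 2 / (4 * θ) - A / d * (r * z) := by
      field_simp
      ring
    linarith
  have h2 : (A / d) ^ 2 * r ^ 2 / (4 * θ) ≤ θ * r ^ 4 + (A / d) ^ 4 / (64 * θ ^ 3) := by
    have : 0 ≤ (8 * θ ^ 2 * r ^ 2 - (A / d) ^ 2) ^ 2 / (64 * θ ^ 3) := by positivity
    have e : (8 * θ ^ 2 * r ^ 2 - (A / d) ^ 2) ^ 2 / (64 * θ ^ 3)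
        = θ * r ^ 4 + (A / d) ^ 4 / (64 * θ ^ 3) - (A / d) ^ 2 * r ^ 2 / (4 * θ) := by
      field_simp
      ring
    linarith
  have h3 : A ^ 4 / (64 * θ ^ 3) / d ^ 4 = (A / d) ^ 4 / (64 * θ ^ 3) := by
    field_simp
  rw [h3]
  linarith


/-! ### The energy estimate -/

theorem exists_young_density {A θ : ℝ} (hθ : 0 < θ) :
    ∃ C : ℝ, 0 ≤ C ∧ ∀ (u w : Fin 3 → E3 → ℝ) (x z : E3) (d : ℝ), 0 < d →
      A / d * (√(magSq u w x) * fluxBound u w z)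
        ≤ θ * (density u w x + density u w z) + C / d ^ 4 := by
  obtain ⟨C, hC, hy⟩ := exists_young (A := A) (θ := θ / 36) (by positivity)
  refine ⟨C, hC, fun u w x z d hd => (hy d _ _ hd).trans ?_⟩
  have h1 := fluxBound_sq_le u w z
  have h2 : √(magSq u w x) ^ 4 ≤ density u w x := by
    have h3 : √(magSq u w x) ^ 4 = (√(magSq u w x) ^ 2) ^ 2 := by ring
    rw [h3, Real.sq_sqrt (magSq_nonneg u w x), density]
    linarith [gradSq_nonneg u w x]
  have h4 := density_nonneg u w x
  have h5 : θ / 36 * (fluxBound u w z ^ 2 + √(magSq u w x) ^ 4)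
      ≤ θ / 36 * (36 * density u w z + 36 * density u w x) := by
    gcongr
    linarith
  linarith

theorem sqrt_mul_fluxBound_le_density (u w : Fin 3 → E3 → ℝ) (x z : E3) :
    √(magSq u w x) * (√(magSq u w z) * fluxBound u w z)
      ≤ 19 * (density u w x + density u w z) := by
  have h1 := fluxBound_sq_le u w z
  have hx := Real.sq_sqrt (magSq_nonneg u w x)
  have hz := Real.sq_sqrt (magSq_nonneg u w z)
  have h2 : magSq u w x ^ 2 ≤ density u w x := by
    unfold density
    linarith [gradSq_nonneg u w x]
  have h3 : magSq u w z ^ 2 ≤ density u w z := by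
    unfold density
    linarith [gradSq_nonneg u w z]
  have h4 : (√(magSq u w x) * √(magSq u w z)) ^ 2 = magSq u w x * magSq u w z := by
    rw [mul_pow, hx, hz]
  nlinarith [sq_nonneg (√(magSq u w x) * √(magSq u w z) - fluxBound u w z),
    sq_nonneg (magSq u w x - magSq u w z), density_nonneg u w x, density_nonneg u w z]

theorem exists_abs_integral_flux_le {L : ℝ} (hL : ∀ t, deriv Real.smoothTransition t ≤ L)
    {θ : ℝ} (hθ : 0 < θ) :
    ∃ C : ℝ, 0 ≤ C ∧ ∀ (u w : Fin 3 → E3 → ℝ) (P : E3 → ℝ), IsMHD u w P →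
      ∀ s d : ℝ, 0 ≤ s → 0 < d →
      |∫ x, ∑ i, pd (radialCutoff s (s + d)) i x * energyFlux u w i x|
        ≤ θ * (∫ x in Metric.closedBall 0 (s + d + d), density u w x)
          + C / d ^ 4 * volume.real (Metric.closedBall (0 : E3) (s + d)) := by
  obtain ⟨C, hC, hy⟩ := exists_young_density (A := 2 * L) (θ := θ / 2) (by positivity)
  refine ⟨C, hC, fun u w P h s d hs hd => ?_⟩
  have hsd : s < s + d := by linarith
  have key := abs_integral_le_of_averages (segMeasure)
    (continuous_density h.smooth_u h.smooth_w) (density_nonneg u w)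
    (h := fun _ => 0) measurable_const (a := s + d) (δ := d) hd.le
    (Filter.Eventually.of_forall fun _ => by simpa using hd.le)
    (f := fun x => ∑ i, pd (radialCutoff s (s + d)) i x * energyFlux u w i x)
    (α := θ) (β := 0) (γ := C / d ^ 4)
    (fun x hx => Finset.sum_eq_zero fun i _ => by
      rw [pd_radialCutoff_eq_zero hs hsd i hx.le, zero_mul])
    hθ.le le_rfl (by positivity) (fun x _ => by
      have h1 : |∑ i, pd (radialCutoff s (s + d)) i x * energyFlux u w i x|
          ≤ 2 * L / d * ∑ i, |energyFlux u w i x| := by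
        rw [Finset.mul_sum]
        refine (Finset.abs_sum_le_sum_abs _ _).trans (Finset.sum_le_sum fun i _ => ?_)
        rw [abs_mul]
        refine mul_le_mul_of_nonneg_right ?_ (abs_nonneg _)
        simpa using abs_pd_radialCutoff_le hL hs hsd i x
      have hL0 : 0 ≤ L := (deriv_smoothTransition_nonneg 0).trans (hL 0)
      have h2 : 2 * L / d * ∑ i, |energyFlux u w i x|
          ≤ 2 * L / d * (√(magSq u w x) * fluxBound u w x) :=
        mul_le_mul_of_nonneg_left (sum_abs_energyFlux_le u w x) (by positivity)
      have h3 := hy u w x x d hd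
      simp only [zero_mul, add_zero]
      linarith)
  simpa using key

theorem IsMollifier.exists_abs_integral_far_le {η : E3 → ℝ} {c₀ : ℝ} (hη : IsMollifier η c₀)
    {τ : ℝ} (hτ : 0 < τ) (hτ1 : τ ≤ 1) {θ : ℝ} (hθ : 0 < θ) :
    ∃ C : ℝ, 0 ≤ C ∧ ∀ (u w : Fin 3 → E3 → ℝ) (P : E3 → ℝ), IsMHD u w P →
      ∀ s d : ℝ, 0 ≤ s → 0 < d →
      |∫ x, ∫ y, η y * (radialCutoff s (s + d) x * ∑ j, u j x * pd P j (x - (τ * d) • y))|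
        ≤ θ * (∫ x in Metric.closedBall 0 (s + d + d), density u w x)
          + C / d ^ 4 * volume.real (Metric.closedBall (0 : E3) (s + d)) := by
  set b := volume.real (Metric.closedBall (0 : E3) 1) with hb
  have hb0 : 0 < b := volume_real_closedBall_pos
  have hc := hη.pos
  obtain ⟨C, hC, hy⟩ := exists_young_density (A := c₀ / τ) (θ := θ / (2 * b)) (by positivity)
  refine ⟨b * C, by positivity, fun u w P h s d hs hd => ?_⟩
  have hsd : s < s + d := by linarith
  have hδ : τ * d ≠ 0 := by positivity
  have hGc := continuous_density h.smooth_u h.smooth_w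
  have hν : (volume.restrict (Metric.closedBall (0 : E3) 1)).real Set.univ = b := by
    rw [measureReal_def, Measure.restrict_apply_univ, hb, measureReal_def]
  have key := abs_integral_le_of_averages (volume.restrict (Metric.closedBall (0 : E3) 1))
    hGc (density_nonneg u w)
    (h := fun y => (τ * d) • y) (by fun_prop) (a := s + d) (δ := d) hd.le
    ((ae_restrict_mem measurableSet_closedBall).mono fun y hy => by
      rw [mem_closedBall_zero_iff] at hy
      rw [norm_smul, Real.norm_of_nonneg (by positivity)]
      calc τ * d * ‖y‖ ≤ 1 * d * 1 := by gcongr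
        _ = d := by ring)
    (f := fun x => ∫ y, η y * (radialCutoff s (s + d) x * ∑ j, u j x * pd P j (x - (τ * d) • y)))
    (α := θ / (2 * b) * b) (β := θ / (2 * b)) (γ := b * C / d ^ 4)
    (fun x hx => by simp [radialCutoff_eq_zero hs hsd hx.le])
    (by positivity) (by positivity) (by positivity) (fun x _ => by
      have h1 : ∀ y, η y * (radialCutoff s (s + d) x * ∑ j, u j x * pd P j (x - (τ * d) • y))
          = η y * ∑ j, (radialCutoff s (s + d) x * u j x) * pd P j (x - (τ * d) • y) := by
        intro y
        rw [Finset.mul_sum]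
        simp only [mul_assoc]
      simp only [h1]
      rw [h.mollified_pressure_eq hη hδ]
      have h2 : ∀ y, |(τ * d)⁻¹ * ∑ i, ∑ j, pd η i y * (radialCutoff s (s + d) x * u j x
            * stressTensor u w i j (x - (τ * d) • y))|
          ≤ θ / (2 * b) * (density u w x + density u w (x - (τ * d) • y)) + C / d ^ 4 := by
        intro y
        have h3 : |∑ i, ∑ j, pd η i y * (radialCutoff s (s + d) x * u j x
            * stressTensor u w i j (x - (τ * d) • y))|
            ≤ c₀ * √(magSq u w x) * ∑ i, ∑ j, |stressTensor u w i j (x - (τ * d) • y)| := by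
          rw [Finset.mul_sum]
          refine (Finset.abs_sum_le_sum_abs _ _).trans (Finset.sum_le_sum fun i _ => ?_)
          rw [Finset.mul_sum]
          refine (Finset.abs_sum_le_sum_abs _ _).trans (Finset.sum_le_sum fun j _ => ?_)
          rw [abs_mul, abs_mul, abs_mul, abs_of_nonneg (radialCutoff_nonneg _ _ _), ← mul_assoc]
          refine mul_le_mul_of_nonneg_right ?_ (abs_nonneg _)
          refine mul_le_mul (hη.pd_le i y) ?_
            (mul_nonneg (radialCutoff_nonneg _ _ _) (abs_nonneg _)) hc.le
          exact (mul_le_of_le_one_left (abs_nonneg _) (radialCutoff_le_one _ _ _)).trans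
            (abs_fst_le_sqrt_magSq u w j x)
        have h4 := sum_abs_stressTensor_le u w (x - (τ * d) • y)
        rw [abs_mul, abs_of_pos (by positivity : 0 < (τ * d)⁻¹)]
        calc _ ≤ (τ * d)⁻¹ * (c₀ * √(magSq u w x) * fluxBound u w (x - (τ * d) • y)) := by
              refine mul_le_mul_of_nonneg_left (h3.trans ?_) (by positivity)
              exact mul_le_mul_of_nonneg_left h4 (by positivity)
          _ = c₀ / τ / d * (√(magSq u w x) * fluxBound u w (x - (τ * d) • y)) := by
              field_simp
          _ ≤ _ := hy u w x _ d hd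
      have hGi : IntegrableOn (fun y => density u w (x - (τ * d) • y))
          (Metric.closedBall (0 : E3) 1) :=
        Continuous.integrableOn_closedBall_E3 (by fun_prop) 0 1
      have hci : ∀ c : ℝ, IntegrableOn (fun _ : E3 => c) (Metric.closedBall (0 : E3) 1) := fun c =>
        Continuous.integrableOn_closedBall_E3 continuous_const 0 1
      have hbi := ((hci (density u w x)).add hGi).const_mul (θ / (2 * b))
      rw [← Real.norm_eq_abs]
      refine (norm_integral_le_of_norm_le (hbi.add (hci (C / d ^ 4)))
        (Filter.Eventually.of_forall fun y => h2 y)).trans (le_of_eq ?_)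
      rw [integral_add' hbi (hci _), integral_const_mul, integral_add' (hci _) hGi,
        integral_const, integral_const, hν, smul_eq_mul, smul_eq_mul]
      ring)
  rw [hν] at key
  have e : θ / (2 * b) * b + θ / (2 * b) * b = θ := by
    field_simp
    ring
  rwa [e] at key

theorem IsMollifier.abs_integral_near_le {η : E3 → ℝ} {c₀ : ℝ} (hη : IsMollifier η c₀)
    {L : ℝ} (hL : ∀ t, deriv Real.smoothTransition t ≤ L) {τ : ℝ} (hτ : 0 < τ) (hτ1 : τ ≤ 1)
    {u w : Fin 3 → E3 → ℝ} {P : E3 → ℝ} (h : IsMHD u w P) {s d : ℝ} (hs : 0 ≤ s) (hd : 0 < d) :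
    |∫ x, (∑ j, pd (radialCutoff s (s + d)) j x * u j x)
        * (P x - ∫ y, η y * P (x - (τ * d) • y))|
      ≤ 228 * L * c₀ * volume.real (Metric.closedBall (0 : E3) 1) * τ
        * ∫ x in Metric.closedBall 0 (s + d + d), density u w x := by
  have hsd : s < s + d := by linarith
  have hL0 : 0 ≤ L := (deriv_smoothTransition_nonneg 0).trans (hL 0)
  have hc := hη.pos
  have hGc := continuous_density h.smooth_u h.smooth_w
  set b := volume.real (Metric.closedBall (0 : E3) 1) with hb
  have hδ0 : 0 ≤ τ * d := by positivity
  have key := abs_integral_le_of_averages segMeasure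
    hGc (density_nonneg u w)
    (h := fun q : ℝ × E3 => (q.1 * (τ * d)) • q.2) (by fun_prop) (a := s + d) (δ := d) hd.le
    ((norm_segShift_le hδ0).mono fun q hq => hq.trans (mul_le_of_le_one_left hd.le hτ1))
    (f := fun x => (∑ j, pd (radialCutoff s (s + d)) j x * u j x)
        * (P x - ∫ y, η y * P (x - (τ * d) • y)))
    (α := 114 * L * c₀ * τ * b) (β := 114 * L * c₀ * τ) (γ := 0)
    (fun x hx => by simp [pd_radialCutoff_eq_zero hs hsd _ hx.le])
    (by positivity) (by positivity) le_rfl (fun x _ => by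
      rw [h.pressure_sub_mollified_eq hη, mul_neg, abs_neg, ← integral_const_mul]
      have h1 : |∑ j, pd (radialCutoff s (s + d)) j x * u j x|
          ≤ 6 * L / d * √(magSq u w x) := by
        calc _ ≤ ∑ j : Fin 3, 2 * L / d * √(magSq u w x) := by
              refine (Finset.abs_sum_le_sum_abs _ _).trans (Finset.sum_le_sum fun j _ => ?_)
              rw [abs_mul]
              refine mul_le_mul ?_ (abs_fst_le_sqrt_magSq u w j x) (abs_nonneg _) (by positivity)
              simpa using abs_pd_radialCutoff_le hL hs hsd j x
          _ = _ := by
              simp only [Finset.sum_const, Finset.card_univ, Fintype.card_fin, nsmul_eq_mul]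
              push_cast
              ring
      have h2 : ∀ᵐ q ∂segMeasure, ‖(∑ j, pd (radialCutoff s (s + d)) j x * u j x)
            * (η q.2 * (τ * d * ∑ j, q.2 j *
          ∑ i, (u i (x - (q.1 * (τ * d)) • q.2) * pd (u j) i (x - (q.1 * (τ * d)) • q.2)
            - w i (x - (q.1 * (τ * d)) • q.2) * pd (w j) i (x - (q.1 * (τ * d)) • q.2))))‖
          ≤ 114 * L * c₀ * τ * (density u w x + density u w (x - (q.1 * (τ * d)) • q.2)) := by
        filter_upwards [ae_segMeasure] with q hq
        set z := x - (q.1 * (τ * d)) • q.2 with hz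
        have h3 : |∑ j, q.2 j * ∑ i, (u i z * pd (u j) i z - w i z * pd (w j) i z)|
            ≤ √(magSq u w z) * fluxBound u w z := by
          refine le_trans ?_ (sum_abs_transport_le u w z)
          refine (Finset.abs_sum_le_sum_abs _ _).trans (Finset.sum_le_sum fun j _ => ?_)
          rw [abs_mul]
          exact mul_le_of_le_one_left (abs_nonneg _) ((abs_coord_le_norm _ _).trans hq.2)
        have h4 := sqrt_mul_fluxBound_le_density u w x z
        rw [Real.norm_eq_abs, abs_mul, abs_mul, abs_mul, abs_of_nonneg (hη.nonneg _),
          abs_of_nonneg hδ0]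
        calc _ ≤ 6 * L / d * √(magSq u w x)
              * (c₀ * (τ * d * (√(magSq u w z) * fluxBound u w z))) := by
              refine mul_le_mul h1 ?_ (mul_nonneg (hη.nonneg _) (by positivity)) (by positivity)
              exact mul_le_mul (hη.le _) (mul_le_mul_of_nonneg_left h3 hδ0) (by positivity) hc.le
          _ = 6 * L * c₀ * τ * (√(magSq u w x) * (√(magSq u w z) * fluxBound u w z)) := by
              field_simp
          _ ≤ 6 * L * c₀ * τ * (19 * (density u w x + density u w z)) :=
              mul_le_mul_of_nonneg_left h4 (by positivity)
          _ = _ := by ring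
      have hGi : Integrable (fun q : ℝ × E3 => density u w (x - (q.1 * (τ * d)) • q.2))
          segMeasure := Continuous.integrable_segMeasure (by fun_prop)
      have hci : Integrable (fun _ : ℝ × E3 => density u w x) segMeasure := integrable_const _
      have hbi := (hci.add hGi).const_mul (114 * L * c₀ * τ)
      rw [← Real.norm_eq_abs]
      refine (norm_integral_le_of_norm_le hbi h2).trans (le_of_eq ?_)
      rw [integral_const_mul, integral_add' hci hGi, integral_const, segMeasure_real_univ,
        smul_eq_mul]
      ring)
  rw [segMeasure_real_univ, ← hb, zero_mul, add_zero] at key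
  refine key.trans (le_of_eq ?_)
  ring

theorem IsMollifier.exists_energy_le {η : E3 → ℝ} {c₀ : ℝ} (hη : IsMollifier η c₀)
    {θ : ℝ} (hθ : 0 < θ) :
    ∃ C : ℝ, 0 ≤ C ∧ ∀ (u w : Fin 3 → E3 → ℝ) (P : E3 → ℝ), IsMHD u w P →
      ∀ s d : ℝ, 0 ≤ s → 0 < d →
      ∫ x in Metric.closedBall 0 s, gradSq u w x
        ≤ θ * (∫ x in Metric.closedBall 0 (s + d + d), density u w x)
          + C / d ^ 4 * volume.real (Metric.closedBall (0 : E3) (s + d)) := by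
  obtain ⟨L, hL0, hL⟩ := exists_deriv_smoothTransition_le
  set b := volume.real (Metric.closedBall (0 : E3) 1) with hb
  have hb0 : 0 < b := volume_real_closedBall_pos
  have hc := hη.pos
  set τ := min 1 (θ / (3 * (228 * L * c₀ * b))) with hτ
  have hτ0 : 0 < τ := lt_min one_pos (by positivity)
  have hτθ : 228 * L * c₀ * b * τ ≤ θ / 3 := by
    have h1 : τ ≤ θ / (3 * (228 * L * c₀ * b)) := min_le_right _ _
    rw [le_div_iff₀ (by positivity)] at h1
    linarith
  obtain ⟨C₁, hC₁, h₁⟩ := exists_abs_integral_flux_le hL (θ := θ / 3) (by positivity)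
  obtain ⟨C₂, hC₂, h₂⟩ := hη.exists_abs_integral_far_le hτ0 (min_le_left _ _) (θ := θ / 3)
    (by positivity)
  refine ⟨C₁ + C₂, by positivity, fun u w P h s d hs hd => ?_⟩
  have hsd : s < s + d := by linarith
  have hφ := smooth_radialCutoff s (s + d)
  have hφ0 : ∀ x, s + d ≤ ‖x‖ → radialCutoff s (s + d) x = 0 := fun x hx =>
    radialCutoff_eq_zero hs hsd hx
  have hφc := hasCompactSupport_of_eq_zero hφ0
  have e1 := h.integral_energy hφ hφc
  have e2 := hη.integral_transport_eq h.smooth_u h.div_u hφ hφ0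
    (fun j x hx => pd_radialCutoff_eq_zero hs hsd j hx) h.smooth_P (τ * d)
  have i1 := (abs_le.1 (h₁ u w P h s d hs hd)).1
  have i2 := (abs_le.1 (h₂ u w P h s d hs hd)).1
  have i3 := (abs_le.1 (hη.abs_integral_near_le hL hτ0 (min_le_left _ _) h hs hd)).2
  rw [← hb] at i3
  have hG0 : 0 ≤ ∫ x in Metric.closedBall 0 (s + d + d), density u w x :=
    integral_nonneg fun x => density_nonneg u w x
  have i4 := mul_le_mul_of_nonneg_right hτθ hG0
  have hSc := continuous_gradSq h.smooth_u h.smooth_w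
  have i5 : ∫ x in Metric.closedBall 0 s, gradSq u w x
      ≤ ∫ x, radialCutoff s (s + d) x * gradSq u w x := by
    have e3 : ∫ x in Metric.closedBall 0 s, gradSq u w x
        = ∫ x in Metric.closedBall 0 s, radialCutoff s (s + d) x * gradSq u w x := by
      refine setIntegral_congr_fun measurableSet_closedBall fun x hx => ?_
      rw [mem_closedBall_zero_iff] at hx
      rw [radialCutoff_eq_one hs hsd hx, one_mul]
    rw [e3]
    refine setIntegral_le_integral ?_ (Filter.Eventually.of_forall fun x => ?_)
    · exact (hφ.continuous.mul hSc).integrable_of_hasCompactSupport hφc.mul_right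
    · exact mul_nonneg (radialCutoff_nonneg _ _ _) (gradSq_nonneg u w x)
  have e4 : (C₁ + C₂) / d ^ 4 * volume.real (Metric.closedBall (0 : E3) (s + d))
      = C₁ / d ^ 4 * volume.real (Metric.closedBall (0 : E3) (s + d))
        + C₂ / d ^ 4 * volume.real (Metric.closedBall (0 : E3) (s + d)) := by ring
  rw [e4]
  linarith


/-! ### Vanishing of the energy -/

theorem IsMollifier.integral_magSq_sq_le {η : E3 → ℝ} {c₀ : ℝ} (hη : IsMollifier η c₀)
    {u w : Fin 3 → E3 → ℝ} (hu : ∀ j, ContDiff ℝ (⊤ : ℕ∞) (u j))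
    (hw : ∀ j, ContDiff ℝ (⊤ : ℕ∞) (w j)) {κ : ℝ} (hκ : 0 < κ)
    (hmu : ∀ j x ε, 0 < ε → |∫ y, η y * u j (x - ε • y)| ≤ κ / ε)
    (hmw : ∀ j x ε, 0 < ε → |∫ y, η y * w j (x - ε • y)| ≤ κ / ε) {s d : ℝ} (hd : 0 < d) :
    ∫ x in Metric.closedBall (0 : E3) s, magSq u w x ^ 2
      ≤ 4608 * (c₀ * volume.real (Metric.closedBall (0 : E3) 1) * κ) ^ 2
          * (∫ x in Metric.closedBall (0 : E3) (s + d), gradSq u w x)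
        + 2304 * (κ / d) ^ 4 * volume.real (Metric.closedBall (0 : E3) s) := by
  have huc := fun j => (hu j).continuous
  have hwc := fun j => (hw j).continuous
  have hud := fun j i => continuous_pd (hu j) i
  have hwd := fun j i => continuous_pd (hw j) i
  have hI : ∀ {f : E3 → ℝ} (_ : Continuous f) (a : ℝ), IntegrableOn f (Metric.closedBall 0 a) :=
    fun hf a => hf.integrableOn_closedBall_E3 0 a
  have h1 : ∫ x in Metric.closedBall (0 : E3) s, magSq u w x ^ 2
      ≤ ∫ x in Metric.closedBall (0 : E3) s, 6 * ∑ j, (u j x ^ 4 + w j x ^ 4) := by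
    refine integral_mono (hI ((continuous_magSq hu hw).pow 2) s) (hI (by fun_prop) s) fun x => ?_
    calc magSq u w x ^ 2 ≤ 3 * ∑ j, (u j x ^ 2 + w j x ^ 2) ^ 2 := by
          simpa [magSq] using sq_sum_le_card_mul_sum_sq (s := (Finset.univ : Finset (Fin 3)))
            (f := fun j => u j x ^ 2 + w j x ^ 2)
      _ ≤ 3 * ∑ j, 2 * (u j x ^ 4 + w j x ^ 4) := by
          gcongr with j
          nlinarith [sq_nonneg (u j x ^ 2 - w j x ^ 2)]
      _ = _ := by
          rw [← Finset.mul_sum]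
          ring
  have h2 : ∫ x in Metric.closedBall (0 : E3) s, 6 * ∑ j, (u j x ^ 4 + w j x ^ 4)
      = 6 * ∑ j, ((∫ x in Metric.closedBall (0 : E3) s, u j x ^ 4)
        + ∫ x in Metric.closedBall (0 : E3) s, w j x ^ 4) := by
    rw [integral_const_mul, integral_finsetSum]
    · congr 1
      refine Finset.sum_congr rfl fun j _ => ?_
      exact integral_add (hI ((huc j).pow 4) s) (hI ((hwc j).pow 4) s)
    · intro j _
      exact hI (by fun_prop) s
  have h3 : ∫ x in Metric.closedBall (0 : E3) (s + d), gradSq u w x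
      = ∑ j, ((∫ x in Metric.closedBall (0 : E3) (s + d), ∑ i, pd (u j) i x ^ 2)
        + ∫ x in Metric.closedBall (0 : E3) (s + d), ∑ i, pd (w j) i x ^ 2) := by
    have e : ∀ x, gradSq u w x = ∑ j, ((∑ i, pd (u j) i x ^ 2) + ∑ i, pd (w j) i x ^ 2) := by
      intro x
      rw [gradSq, Finset.sum_comm]
      simp only [Finset.sum_add_distrib]
    simp only [e]
    rw [integral_finsetSum]
    · refine Finset.sum_congr rfl fun j _ => ?_
      exact integral_add (hI (by fun_prop) _) (hI (by fun_prop) _)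
    · intro j _
      exact hI (by fun_prop) _
  have h4 := fun j => hη.integral_pow_four_le (hu j) hκ (hmu j) (s := s) hd
  have h5 := fun j => hη.integral_pow_four_le (hw j) hκ (hmw j) (s := s) hd
  refine h1.trans ?_
  rw [h2, h3]
  refine (mul_le_mul_of_nonneg_left
    (Finset.sum_le_sum fun j _ => add_le_add (h4 j) (h5 j)) (by norm_num)).trans (le_of_eq ?_)
  simp only [Fin.sum_univ_three]
  ring

theorem volume_real_closedBall_le {a R : ℝ} (haR : a ≤ R) (hR : 0 ≤ R) :
    volume.real (Metric.closedBall (0 : E3) a)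
      ≤ R ^ 3 * volume.real (Metric.closedBall (0 : E3) 1) := by
  have h1 : volume.real (Metric.closedBall (0 : E3) R)
      = R ^ 3 * volume.real (Metric.closedBall (0 : E3) 1) := by
    rw [Measure.addHaar_real_closedBall volume 0 hR,
      Measure.addHaar_real_closedBall_eq_addHaar_real_ball volume 0 1]
    simp
  rw [← h1]
  exact measureReal_mono (Metric.closedBall_subset_closedBall haR) measure_closedBall_lt_top.ne

theorem setIntegral_closedBall_mono {f : E3 → ℝ} (hf : Continuous f) (h0 : ∀ x, 0 ≤ f x)
    {a b : ℝ} (hab : a ≤ b) :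
    ∫ x in Metric.closedBall (0 : E3) a, f x ≤ ∫ x in Metric.closedBall (0 : E3) b, f x :=
  setIntegral_mono_set (hf.integrableOn_closedBall_E3 0 b)
    (Filter.Eventually.of_forall h0)
    (Metric.closedBall_subset_closedBall hab).eventuallyLE

theorem IsMHD.exists_absorption {η : E3 → ℝ} {c₀ : ℝ} (hη : IsMollifier η c₀)
    {u w : Fin 3 → E3 → ℝ} {P : E3 → ℝ} (h : IsMHD u w P) {κ : ℝ} (hκ : 0 < κ)
    (hmu : ∀ j x ε, 0 < ε → |∫ y, η y * u j (x - ε • y)| ≤ κ / ε)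
    (hmw : ∀ j x ε, 0 < ε → |∫ y, η y * w j (x - ε • y)| ≤ κ / ε) {θ : ℝ} (hθ : 0 < θ) :
    ∃ C : ℝ, 0 ≤ C ∧ ∀ s t R : ℝ, 0 ≤ s → s < t → t ≤ R →
      ∫ x in Metric.closedBall 0 s, gradSq u w x
        ≤ θ * (∫ x in Metric.closedBall 0 t, gradSq u w x) + C * R ^ 3 / (t - s) ^ 4 := by
  set b := volume.real (Metric.closedBall (0 : E3) 1) with hb
  have hb0 : 0 < b := volume_real_closedBall_pos
  set A := 4608 * (c₀ * b * κ) ^ 2 with hA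
  have hA0 : 0 ≤ A := by positivity
  set θ' := θ / (1 + A) with hθ'
  have hθ'0 : 0 < θ' := by positivity
  obtain ⟨C, hC, hE⟩ := hη.exists_energy_le hθ'0
  refine ⟨81 * ((θ' * (2304 * κ ^ 4) + C) * b), by positivity, fun s t R hs hst htR => ?_⟩
  set d := (t - s) / 3 with hd
  have hd0 : 0 < d := by
    have : 0 < t - s := by linarith
    positivity
  have hR : 0 ≤ R := by linarith
  have hts : t - s = 3 * d := by
    rw [hd]
    ring
  have hSc := continuous_gradSq h.smooth_u h.smooth_w
  have hUc := continuous_magSq h.smooth_u h.smooth_w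
  have e1 := hE u w P h s d hs hd0
  have e2 := hη.integral_magSq_sq_le h.smooth_u h.smooth_w hκ hmu hmw (s := s + d + d) hd0
  have e3 : s + d + d + d = t := by linarith
  rw [← hb, ← hA, e3] at e2
  have e4 : ∫ x in Metric.closedBall 0 (s + d + d), density u w x
      = (∫ x in Metric.closedBall 0 (s + d + d), gradSq u w x)
        + ∫ x in Metric.closedBall 0 (s + d + d), magSq u w x ^ 2 :=
    integral_add (hSc.integrableOn_closedBall_E3 0 _) ((hUc.pow 2).integrableOn_closedBall_E3 0 _)
  have e5 : ∫ x in Metric.closedBall 0 (s + d + d), gradSq u w x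
      ≤ ∫ x in Metric.closedBall 0 t, gradSq u w x :=
    setIntegral_closedBall_mono hSc (gradSq_nonneg u w) (by linarith)
  have v1 : volume.real (Metric.closedBall (0 : E3) (s + d + d)) ≤ R ^ 3 * b :=
    volume_real_closedBall_le (by linarith) hR
  have v2 : volume.real (Metric.closedBall (0 : E3) (s + d)) ≤ R ^ 3 * b :=
    volume_real_closedBall_le (by linarith) hR
  set E := ∫ x in Metric.closedBall 0 t, gradSq u w x with hEt
  have e6 : ∫ x in Metric.closedBall 0 (s + d + d), density u w x
      ≤ (1 + A) * E + 2304 * (κ / d) ^ 4 * (R ^ 3 * b) := by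
    rw [e4]
    have := mul_le_mul_of_nonneg_left v1 (by positivity : 0 ≤ 2304 * (κ / d) ^ 4)
    linarith
  have e7 : C / d ^ 4 * volume.real (Metric.closedBall (0 : E3) (s + d))
      ≤ C / d ^ 4 * (R ^ 3 * b) := mul_le_mul_of_nonneg_left v2 (by positivity)
  refine e1.trans ((add_le_add (mul_le_mul_of_nonneg_left e6 hθ'0.le) e7).trans (le_of_eq ?_))
  have e8 : θ' * ((1 + A) * E) = θ * E := by
    rw [hθ']
    field_simp
  rw [mul_add, e8, hts]
  field_simp
  ring

theorem eq_zero_of_absorption {E : ℝ → ℝ} (hmono : Monotone E) (h0 : ∀ s, 0 ≤ E s) {C : ℝ}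
    (hC : 0 ≤ C) (h : ∀ s t R : ℝ, 0 ≤ s → s < t → t ≤ R →
      E s ≤ 1 / 32 * E t + C * R ^ 3 / (t - s) ^ 4) (ρ : ℝ) : E ρ = 0 := by
  have h1 : ∀ R : ℝ, 0 < R → ∀ n : ℕ, ∀ s, 0 ≤ s → s ≤ R →
      (R - s) ^ 4 * E s ≤ R ^ 4 * E R * (1 / 2) ^ n + 32 * (C * R ^ 3) := by
    intro R hR n
    induction n with
    | zero =>
      intro s hs hsR
      have : (R - s) ^ 4 * E s ≤ R ^ 4 * E R := by
        refine mul_le_mul (pow_le_pow_left₀ (by linarith) (by linarith) 4) (hmono hsR) (h0 s)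
          (by positivity)
      have : 0 ≤ 32 * (C * R ^ 3) := by positivity
      simp only [pow_zero, mul_one]
      linarith
    | succ n ih =>
      intro s hs hsR
      rcases hsR.eq_or_lt with rfl | hlt
      · have := h0 s
        rw [sub_self, zero_pow (by norm_num), zero_mul]
        positivity
      · have h2 := ih ((s + R) / 2) (by linarith) (by linarith)
        have h3 := h s ((s + R) / 2) R hs (by linarith) (by linarith)
        have h4 : (s + R) / 2 - s = (R - s) / 2 := by ring
        have h5 : R - (s + R) / 2 = (R - s) / 2 := by ring
        have h6 : 0 < R - s := by linarith
        rw [h4] at h3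
        rw [h5] at h2
        have h7 := mul_le_mul_of_nonneg_left h3 (by positivity : 0 ≤ (R - s) ^ 4)
        have h8 : (R - s) ^ 4 * (1 / 32 * E ((s + R) / 2) + C * R ^ 3 / ((R - s) / 2) ^ 4)
            = 1 / 2 * (((R - s) / 2) ^ 4 * E ((s + R) / 2)) + 16 * (C * R ^ 3) := by
          field_simp
          ring
        rw [h8] at h7
        rw [pow_succ (1 / 2 : ℝ) n]
        linarith
  have h2 : ∀ R : ℝ, 0 < R → E (R / 2) ≤ 512 * C / R := by
    intro R hR
    have h3 : Filter.Tendsto (fun n : ℕ => R ^ 4 * E R * (1 / 2) ^ n + 32 * (C * R ^ 3))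
        Filter.atTop (nhds (R ^ 4 * E R * 0 + 32 * (C * R ^ 3))) :=
      ((tendsto_pow_atTop_nhds_zero_of_lt_one (by norm_num) (by norm_num)).const_mul _).add_const _
    have h4 := ge_of_tendsto' h3 fun n => h1 R hR n (R / 2) (by linarith) (by linarith)
    rw [le_div_iff₀ hR]
    have h5 : 0 < R ^ 3 := by positivity
    refine le_of_mul_le_mul_right ?_ h5
    nlinarith
  refine le_antisymm ?_ (h0 ρ)
  have h3 : Filter.Tendsto (fun R : ℝ => 512 * C / R) Filter.atTop (nhds 0) :=
    Filter.Tendsto.div_atTop tendsto_const_nhds Filter.tendsto_id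
  refine ge_of_tendsto h3 ?_
  filter_upwards [Filter.eventually_ge_atTop (2 * ρ), Filter.eventually_gt_atTop 0] with R hR hR0
  exact (hmono (by linarith)).trans (h2 R hR0)

theorem IsMHD.gradSq_eq_zero {η : E3 → ℝ} {c₀ : ℝ} (hη : IsMollifier η c₀)
    {u w : Fin 3 → E3 → ℝ} {P : E3 → ℝ} (h : IsMHD u w P) {κ : ℝ} (hκ : 0 < κ)
    (hmu : ∀ j x ε, 0 < ε → |∫ y, η y * u j (x - ε • y)| ≤ κ / ε)
    (hmw : ∀ j x ε, 0 < ε → |∫ y, η y * w j (x - ε • y)| ≤ κ / ε) (x : E3) :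
    gradSq u w x = 0 := by
  have hSc := continuous_gradSq h.smooth_u h.smooth_w
  obtain ⟨C, hC, hE⟩ := h.exists_absorption hη hκ hmu hmw (θ := 1 / 32) (by norm_num)
  have h1 := eq_zero_of_absorption
    (E := fun s => ∫ x in Metric.closedBall 0 s, gradSq u w x)
    (fun a b hab => setIntegral_closedBall_mono hSc (gradSq_nonneg u w) hab)
    (fun s => integral_nonneg fun x => gradSq_nonneg u w x) hC hE (‖x‖ + 1)
  have h2 := (integral_eq_zero_iff_of_nonneg (fun x => gradSq_nonneg u w x)
    (hSc.integrableOn_closedBall_E3 0 (‖x‖ + 1))).1 h1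
  have h3 : gradSq u w =ᵐ[volume.restrict (Metric.ball (0 : E3) (‖x‖ + 1))] 0 :=
    ae_restrict_of_ae_restrict_of_subset Metric.ball_subset_closedBall h2
  exact Measure.eqOn_open_of_ae_eq h3 Metric.isOpen_ball hSc.continuousOn continuousOn_const
    (by simp)

theorem IsMollifier.eq_zero_of_pd_eq_zero {η : E3 → ℝ} {c₀ : ℝ} (hη : IsMollifier η c₀)
    {f : E3 → ℝ} (hf : ContDiff ℝ (⊤ : ℕ∞) f) (h0 : ∀ i x, pd f i x = 0) {κ : ℝ}
    (hm : ∀ x ε, 0 < ε → |∫ y, η y * f (x - ε • y)| ≤ κ / ε) (x : E3) : f x = 0 := by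
  have h1 : ∀ x, fderiv ℝ f x = 0 := by
    intro x
    ext y
    rw [fderiv_apply_eq_sum_pd]
    simp [h0]
  have h2 : ∀ y, f y = f x := fun y =>
    is_const_of_fderiv_eq_zero (differentiable_of_smooth hf) h1 y x
  have h3 : ∀ ε : ℝ, 0 < ε → |f x| ≤ κ / ε := by
    intro ε hε
    have := hm x ε hε
    simp only [h2 (x - _)] at this
    rwa [integral_mul_const, hη.integral_eq, one_mul] at this
  have h4 : Filter.Tendsto (fun ε : ℝ => κ / ε) Filter.atTop (nhds 0) :=
    Filter.Tendsto.div_atTop tendsto_const_nhds Filter.tendsto_id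
  refine abs_nonpos_iff.1 (ge_of_tendsto h4 ?_)
  filter_upwards [Filter.eventually_gt_atTop 0] with ε hε
  exact h3 ε hε

theorem IsMHD.eq_zero {η : E3 → ℝ} {c₀ : ℝ} (hη : IsMollifier η c₀)
    {u w : Fin 3 → E3 → ℝ} {P : E3 → ℝ} (h : IsMHD u w P) {κ : ℝ} (hκ : 0 < κ)
    (hmu : ∀ j x ε, 0 < ε → |∫ y, η y * u j (x - ε • y)| ≤ κ / ε)
    (hmw : ∀ j x ε, 0 < ε → |∫ y, η y * w j (x - ε • y)| ≤ κ / ε) (j : Fin 3) (x : E3) :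
    u j x = 0 ∧ w j x = 0 := by
  have h1 : ∀ i j x, pd (u j) i x ^ 2 + pd (w j) i x ^ 2 = 0 := by
    intro i j x
    have h2 := h.gradSq_eq_zero hη hκ hmu hmw x
    rw [gradSq, Finset.sum_eq_zero_iff_of_nonneg
      fun i _ => Finset.sum_nonneg fun j _ => by positivity] at h2
    have h3 := h2 i (Finset.mem_univ i)
    rw [Finset.sum_eq_zero_iff_of_nonneg fun j _ => by positivity] at h3
    exact h3 j (Finset.mem_univ j)
  constructor
  · refine hη.eq_zero_of_pd_eq_zero (h.smooth_u j) (fun i x => ?_) (hmu j) x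
    nlinarith [h1 i j x, sq_nonneg (pd (u j) i x), sq_nonneg (pd (w j) i x)]
  · refine hη.eq_zero_of_pd_eq_zero (h.smooth_w j) (fun i x => ?_) (hmw j) x
    nlinarith [h1 i j x, sq_nonneg (pd (u j) i x), sq_nonneg (pd (w j) i x)]


/-- **Corollary.**  If `(v, B, p)` is a smooth solution of the stationary MHD system with
`v, B ∈ BMO⁻¹(ℝ³)`, i.e. `v = ∇·Φ`, `B = ∇·Ψ` with `Φ, Ψ ∈ BMO`, then `v ≡ 0`, `B ≡ 0`. -/
theorem stmt_12 (v B : E3 → Fin 3 → ℝ) (p : E3 → ℝ)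
    (hv : ContDiff ℝ (⊤ : ℕ∞) v) (hB : ContDiff ℝ (⊤ : ℕ∞) B) (hp : ContDiff ℝ (⊤ : ℕ∞) p)
    (heq1 : ∀ x j, -(lap (fun y => v y j) x) + (∑ i, v x i * pd (fun y => v y j) i x)
      = -(pd p j x) + ∑ i, B x i * pd (fun y => B y j) i x)
    (heq2 : ∀ x j, -(lap (fun y => B y j) x) + (∑ i, v x i * pd (fun y => B y j) i x)
      - (∑ i, B x i * pd (fun y => v y j) i x) = 0)
    (hdivv : ∀ x, divg v x = 0) (hdivB : ∀ x, divg B x = 0)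
    (Φ Ψ : E3 → Fin 3 → Fin 3 → ℝ) (hΦ : ContDiff ℝ (⊤ : ℕ∞) Φ) (hΨ : ContDiff ℝ (⊤ : ℕ∞) Ψ)
    (hΦv : ∀ x j, matDiv Φ x j = v x j) (hΨB : ∀ x j, matDiv Ψ x j = B x j)
    (hΦBMO : IsBMO Φ) (hΨBMO : IsBMO Ψ) :
    (∀ x, v x = 0) ∧ (∀ x, B x = 0) := by
  obtain ⟨η, c, hη⟩ := exists_isMollifier
  obtain ⟨κ₁, hκ₁, hm₁⟩ := hΦBMO.exists_abs_mollified_le hη hΦ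
  obtain ⟨κ₂, hκ₂, hm₂⟩ := hΨBMO.exists_abs_mollified_le hη hΨ
  simp only [hΦv] at hm₁
  simp only [hΨB] at hm₂
  have h : IsMHD (fun j x => v x j) (fun j x => B x j) p :=
    ⟨contDiff_pi.1 hv, contDiff_pi.1 hB, hp, heq1, heq2, hdivv, hdivB⟩
  have key := h.eq_zero hη (add_pos hκ₁ hκ₂)
    (fun j x ε hε => (hm₁ j x ε hε).trans (by gcongr; linarith))
    (fun j x ε hε => (hm₂ j x ε hε).trans (by gcongr; linarith))
  exact ⟨fun x => funext fun j => (key j x).1, fun x => funext fun j => (key j x).2⟩
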